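/- arXiv:2008.10552 — 4 statements merged into one kernel-verified Lean document; each statement's English description precedes it below -/
import Mathlib

section
/- Let n ≥ 5 and suppose there exist n−1 mutually orthogonal Latin squares of order n. Then there exists a uniform ((n+1)×(n+1))/((n−2)n) semi-Latin square S̄ such that η_{n+1}(S̄) = n(n−2)(n−3)/2, η_{n−2}(S̄) = n²(n−1)(n−2)/2, η₂(S̄) = n²(n−2)(n−3)(2n−1)/2, η₁(S̄) = n(n−1)(n−2)(n³−4n²+8n−2)/2, η₀(S̄) = n²(n−2)(3n²−9n+4)/2, and η_m(S̄) = 0 for every non-negative integer m not in {0, 1, 2, n−2, n+1}. -/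
open Polynomial

/-- A `(v,b,r,k)`-design: `b` blocks (indexed by `Fin b`, so repeated blocks are allowed),
each a `k`-subset of the `v` treatments, with each treatment in exactly `r` blocks. -/
structure BlockDesign (v b r k : ℕ) where
  blocks : Fin b → Finset (Fin v)
  blockSize : ∀ j, (blocks j).card = k
  replication : ∀ α : Fin v, (Finset.univ.filter fun j => α ∈ blocks j).card = r

namespace BlockDesign

variable {v b r k : ℕ}

/-- The concurrence of two treatments: the number of blocks containing both. -/
def concurrence (D : BlockDesign v b r k) (α β : Fin v) : ℕ :=
  (Finset.univ.filter fun j => α ∈ D.blocks j ∧ β ∈ D.blocks j).card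

/-- The scaled information matrix `F(Δ) = I − (rk)⁻¹ Λ`. -/
noncomputable def infoMatrix (D : BlockDesign v b r k) : Matrix (Fin v) (Fin v) ℝ :=
  1 - ((r : ℝ) * (k : ℝ))⁻¹ • Matrix.of (fun α β => (D.concurrence α β : ℝ))

/-- `η_i(Δ)`: the number of unordered pairs of distinct treatments with concurrence `i`. -/
def eta (D : BlockDesign v b r k) (i : ℕ) : ℕ :=
  (Finset.univ.filter fun p : Fin v × Fin v => p.1 < p.2 ∧ D.concurrence p.1 p.2 = i).card

/-- `π : Fin b → Fin r` assigns blocks to parallel classes, each class partitioning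
the treatment set. -/
def IsResolution (D : BlockDesign v b r k) (π : Fin b → Fin r) : Prop :=
  ∀ (c : Fin r) (α : Fin v), ∃! j : Fin b, π j = c ∧ α ∈ D.blocks j

def IsResolvable (D : BlockDesign v b r k) : Prop :=
  k < v ∧ 1 < r ∧ ∃ π : Fin b → Fin r, D.IsResolution π

def IsAffineResolvable (D : BlockDesign v b r k) : Prop :=
  k < v ∧ 1 < r ∧ ∃ π : Fin b → Fin r, D.IsResolution π ∧
    ∃ μ : ℕ, 0 < μ ∧ ∀ j j' : Fin b, π j ≠ π j' → (D.blocks j ∩ D.blocks j').card = μ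

/-- The canonical efficiency factors, as a multiset: the eigenvalues (with multiplicity,
i.e. the roots of the characteristic polynomial) of the scaled information matrix,
with one copy of the eigenvalue `0` removed. -/
noncomputable def effFactors (D : BlockDesign v b r k) : Multiset ℝ :=
  (D.infoMatrix.charpoly.roots).erase 0

/-- The canonical efficiency factors, sorted increasingly. -/
noncomputable def sortedEff (D : BlockDesign v b r k) : List ℝ :=
  D.effFactors.sort (· ≤ ·)

/-- `D` is Schur optimal in a class `C` of `(v,b,r,k)`-designs. -/
def SchurOptimalIn (D : BlockDesign v b r k) (C : Set (BlockDesign v b r k)) : Prop :=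
  D ∈ C ∧ ∀ Γ ∈ C, ∀ ℓ : ℕ, 1 ≤ ℓ → ℓ ≤ v - 1 →
    ((Γ.sortedEff).take ℓ).sum ≤ ((D.sortedEff).take ℓ).sum

/-- `D` is an `s`-fold inflation of `E`. -/
def IsInflation (s : ℕ) {w m : ℕ} (D : BlockDesign v b r k) (E : BlockDesign w b r m) : Prop :=
  ∃ e : Fin v ≃ Fin w × Fin s, ∀ (α : Fin v) (j : Fin b), α ∈ D.blocks j ↔ (e α).1 ∈ E.blocks j

/-- `D` is a `(v,b,r,k,λ)`-balanced incomplete-block design. -/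
def IsBIBD (D : BlockDesign v b r k) (lam : ℕ) : Prop :=
  1 < k ∧ k < v ∧ ∀ α β : Fin v, α ≠ β → D.concurrence α β = lam

end BlockDesign

/-- An `(n×n)/k` semi-Latin square. -/
structure SemiLatinSquare (n k : ℕ) where
  block : Fin n → Fin n → Finset (Fin (n * k))
  blockSize : ∀ i j, (block i j).card = k
  row_once : ∀ (i : Fin n) (α : Fin (n * k)), ∃! j : Fin n, α ∈ block i j
  col_once : ∀ (j : Fin n) (α : Fin (n * k)), ∃! i : Fin n, α ∈ block i j

namespace SemiLatinSquare

variable {n k : ℕ}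

/-- `S` is uniform with intersection parameter `μ`. -/
def UniformWith (S : SemiLatinSquare n k) (μ : ℕ) : Prop :=
  0 < μ ∧ ∀ i j i' j' : Fin n, i ≠ i' → j ≠ j' →
    (S.block i j ∩ S.block i' j').card = μ

def IsUniform (S : SemiLatinSquare n k) : Prop := ∃ μ : ℕ, S.UniformWith μ

/-- Concurrence in the underlying block design of `S`. -/
def concurrence (S : SemiLatinSquare n k) (α β : Fin (n * k)) : ℕ :=
  (Finset.univ.filter fun p : Fin n × Fin n =>
    α ∈ S.block p.1 p.2 ∧ β ∈ S.block p.1 p.2).card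

/-- The scaled information matrix of the underlying block design of `S`
(which is an `(nk, n², n, k)`-design, so `rk = nk`). -/
noncomputable def infoMatrix (S : SemiLatinSquare n k) :
    Matrix (Fin (n * k)) (Fin (n * k)) ℝ :=
  1 - ((n : ℝ) * (k : ℝ))⁻¹ • Matrix.of (fun α β => (S.concurrence α β : ℝ))

/-- `η_i(S)`: the number of unordered pairs of distinct treatments with concurrence `i`. -/
def eta (S : SemiLatinSquare n k) (i : ℕ) : ℕ :=
  (Finset.univ.filter fun p : Fin (n * k) × Fin (n * k) =>
    p.1 < p.2 ∧ S.concurrence p.1 p.2 = i).card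

/-- Canonical efficiency factors of `S` (eigenvalues of the scaled information matrix,
with multiplicity, after removing one copy of `0`). -/
noncomputable def effFactors (S : SemiLatinSquare n k) : Multiset ℝ :=
  (S.infoMatrix.charpoly.roots).erase 0

noncomputable def sortedEff (S : SemiLatinSquare n k) : List ℝ :=
  S.effFactors.sort (· ≤ ·)

/-- `S` is Schur optimal in the class of all `(n×n)/k` semi-Latin squares
(on the same treatment set). -/
def SchurOptimal (S : SemiLatinSquare n k) : Prop :=
  ∀ T : SemiLatinSquare n k, ∀ ℓ : ℕ, 1 ≤ ℓ → ℓ ≤ n * k - 1 →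
    ((T.sortedEff).take ℓ).sum ≤ ((S.sortedEff).take ℓ).sum

/-- `S` is an `s`-fold inflation of `T`. -/
def IsInflation (s : ℕ) (S : SemiLatinSquare n (s * k)) (T : SemiLatinSquare n k) : Prop :=
  ∃ e : Fin (n * (s * k)) ≃ Fin (n * k) × Fin s,
    ∀ (α : Fin (n * (s * k))) (i j : Fin n), α ∈ S.block i j ↔ (e α).1 ∈ T.block i j

/-- The PV-aberration vector `(η₀(S), …, η_n(S))`. -/
def etaVec (S : SemiLatinSquare n k) : List ℕ :=
  (List.range (n + 1)).map (S.eta)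

/-- `S` has minimum PV aberration in the class of uniform `(n×n)/k` semi-Latin squares:
no uniform square has a lexicographically smaller `η`-vector. -/
def MinPVAberration (S : SemiLatinSquare n k) : Prop :=
  ∀ T : SemiLatinSquare n k, T.IsUniform → ¬ List.Lex (· < ·) (T.etaVec) (S.etaVec)

end SemiLatinSquare

/-- `L` is a Latin square of order `n` (symbols `Fin n`). -/
def IsLatin (n : ℕ) (L : Fin n → Fin n → Fin n) : Prop :=
  (∀ (i a : Fin n), ∃! j : Fin n, L i j = a) ∧ (∀ (j a : Fin n), ∃! i : Fin n, L i j = a)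

/-- Two Latin squares of order `n` are orthogonal: each pair of symbols occurs together
in exactly one cell of the superposition. -/
def AreOrthogonal {n : ℕ} (L M : Fin n → Fin n → Fin n) : Prop :=
  ∀ a b : Fin n, ∃! p : Fin n × Fin n, L p.1 p.2 = a ∧ M p.1 p.2 = b

/-- A family of mutually orthogonal Latin squares of order `n`. -/
def IsMOLS {n m : ℕ} (L : Fin m → Fin n → Fin n → Fin n) : Prop :=
  (∀ t, IsLatin n (L t)) ∧ ∀ t t', t ≠ t' → AreOrthogonal (L t) (L t')

/-- `S` is a `μ`-fold inflation of a superposition of `n−1` mutually orthogonal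
Latin squares of order `n` (with pairwise disjoint symbol sets): the treatments of `S`
are identified with triples `((t, a), c)` where `t` indexes the Latin square, `a` is a
symbol, and `c` is the inflation index, and treatment `((t,a),c)` lies in block `(i,j)`
iff Latin square `t` has symbol `a` in cell `(i,j)`. -/
def SemiLatinSquare.IsInflatedMOLSSuperposition {n k : ℕ} (μ : ℕ)
    (S : SemiLatinSquare n k) : Prop :=
  ∃ L : Fin (n - 1) → Fin n → Fin n → Fin n, IsMOLS L ∧
    ∃ e : Fin (n * k) ≃ (Fin (n - 1) × Fin n) × Fin μ,
      ∀ (α : Fin (n * k)) (i j : Fin n),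
        α ∈ S.block i j ↔ L (e α).1.1 i j = (e α).1.2

open Finset in
theorem aux_transport {P T : Type} [Fintype P] [Fintype T] [DecidableEq P] [DecidableEq T]
    (N k μ : ℕ) (hP : Fintype.card P = N) (hT : Fintype.card T = N * k) (hN : 2 ≤ N)
    (hk : k = (N - 1) * μ) (hμ : 0 < μ) (f : T → Equiv.Perm P)
    (hu : ∀ x y x' y' : P, x ≠ x' → y ≠ y' →
      (univ.filter fun α : T => f α x = y ∧ f α x' = y').card = μ) :
    ∃ S : SemiLatinSquare N k, S.IsUniform ∧ ∀ m : ℕ,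
      2 * S.eta m = (univ.filter fun p : T × T => p.1 ≠ p.2 ∧
        (univ.filter fun x : P => f p.1 x = f p.2 x).card = m).card := by
  have hbs : ∀ x y : P, (univ.filter fun α : T => f α x = y).card = k := by
    intro x y
    have : ∃ x', x ≠ x' := by
      have : Nontrivial P := Fintype.one_lt_card_iff_nontrivial.mp (by omega)
      obtain ⟨z, hz⟩ := exists_ne x
      exact ⟨z, hz.symm⟩
    obtain ⟨x', hx'⟩ := this
    rw [Finset.card_eq_sum_card_fiberwise (f := fun α : T => f α x') (t := univ.erase y)]
    · rw [Finset.sum_congr rfl (g := fun _ => μ)]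
      · rw [Finset.sum_const, Finset.card_erase_of_mem (mem_univ _), Finset.card_univ, hP, hk]
        rfl
      · intro y' hy'
        rw [Finset.filter_filter]
        exact hu x y x' y' hx' (Finset.ne_of_mem_erase hy').symm
    · intro α hα
      simp only [coe_filter, mem_univ, true_and, Set.mem_ofPred_eq] at hα
      simp only [coe_erase, coe_univ, Set.mem_sdiff, Set.mem_univ, Set.mem_singleton_iff, true_and]
      rw [← hα]
      exact fun h => hx' ((f α).injective h).symm
  have eP : Fin N ≃ P := (Fintype.equivFinOfCardEq hP).symm
  have eT : Fin (N * k) ≃ T := (Fintype.equivFinOfCardEq hT).symm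
  let S : SemiLatinSquare N k :=
    { block := fun i j => univ.filter fun α => f (eT α) (eP i) = eP j
      blockSize := by
        intro i j
        refine Eq.trans ?_ (hbs (eP i) (eP j))
        exact Finset.card_equiv eT (by intro a; simp)
      row_once := by
        intro i α
        refine ⟨eP.symm (f (eT α) (eP i)), by simp, ?_⟩
        intro j hj
        simp only [mem_filter, mem_univ, true_and] at hj
        rw [hj]; simp
      col_once := by
        intro j α
        refine ⟨eP.symm ((f (eT α)).symm (eP j)), by simp, ?_⟩
        intro i hi
        simp only [mem_filter, mem_univ, true_and] at hi
        rw [← hi]; simp }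
  have hblock : ∀ i j α, α ∈ S.block i j ↔ f (eT α) (eP i) = eP j := by
    intro i j α
    simp [S]
  have hconc : ∀ α β, S.concurrence α β =
      (univ.filter fun x : P => f (eT α) x = f (eT β) x).card := by
    intro α β
    unfold SemiLatinSquare.concurrence
    simp only [hblock]
    refine Finset.card_bij' (fun p _ => eP p.1) (fun x _ => (eP.symm x, eP.symm (f (eT α) x)))
      ?_ ?_ ?_ ?_
    · intro p hp
      simp only [mem_filter, mem_univ, true_and] at hp ⊢
      rw [hp.1, hp.2]
    · intro x hx
      simp only [mem_filter, mem_univ, true_and] at hx ⊢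
      simp [hx]
    · intro p hp
      simp only [mem_filter, mem_univ, true_and] at hp ⊢
      rw [hp.1]; simp
    · intro x hx
      simp
  refine ⟨S, ⟨μ, hμ, ?_⟩, ?_⟩
  · intro i j i' j' hi hj
    rw [← hu (eP i) (eP j) (eP i') (eP j') (by simpa using hi) (by simpa using hj)]
    refine Finset.card_equiv eT ?_
    intro a
    simp [hblock]
  · intro m
    have hsym : ∀ α β, S.concurrence α β = S.concurrence β α := by
      intro α β
      unfold SemiLatinSquare.concurrence
      simp only [and_comm]
    have h1 : (univ.filter fun p : T × T => p.1 ≠ p.2 ∧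
        (univ.filter fun x : P => f p.1 x = f p.2 x).card = m).card =
        (univ.filter fun p : Fin (N * k) × Fin (N * k) => p.1 ≠ p.2 ∧
          S.concurrence p.1 p.2 = m).card := by
      symm
      refine Finset.card_equiv (Equiv.prodCongr eT eT) ?_
      intro p
      simp [hconc]
    have h2 : (univ.filter fun p : Fin (N * k) × Fin (N * k) => p.1 ≠ p.2 ∧
          S.concurrence p.1 p.2 = m) =
        (univ.filter fun p : Fin (N * k) × Fin (N * k) => p.1 < p.2 ∧
          S.concurrence p.1 p.2 = m) ∪
        (univ.filter fun p : Fin (N * k) × Fin (N * k) => p.2 < p.1 ∧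
          S.concurrence p.1 p.2 = m) := by
      ext p
      simp only [mem_filter, mem_univ, true_and, mem_union]
      rw [← or_and_right, ne_iff_lt_or_gt]
    have h3 : (univ.filter fun p : Fin (N * k) × Fin (N * k) => p.2 < p.1 ∧
          S.concurrence p.1 p.2 = m).card = S.eta m := by
      unfold SemiLatinSquare.eta
      refine Finset.card_equiv (Equiv.prodComm _ _) ?_
      intro p
      simp [hsym p.1 p.2]
    rw [h1, h2, Finset.card_union_of_disjoint, h3]
    · unfold SemiLatinSquare.eta; ring
    · rw [Finset.disjoint_left]
      intro p hp hp'
      simp only [mem_filter, mem_univ, true_and] at hp hp'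
      exact absurd hp.1 (not_lt.mpr hp'.1.le)

/-- treatments -/
abbrev AuxT (m : ℕ) : Type := (Fin (m + 2) × Fin m) ⊕ (Fin m × Fin (m + 2) × Fin (m + 2))

/-- prolongation -/
def auxF {m : ℕ} (g : Fin (m + 1) → Fin (m + 2) → Equiv.Perm (Fin (m + 2))) :
    AuxT m → Equiv.Perm (Option (Fin (m + 2)))
  | Sum.inl (a, _) => (g 0 a).optionCongr
  | Sum.inr (t, a, i) => (g t.succ a).optionCongr * Equiv.swap none (some i)

section
variable {m : ℕ} (g : Fin (m + 1) → Fin (m + 2) → Equiv.Perm (Fin (m + 2)))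

theorem auxF_inl_none (a c) : auxF g (Sum.inl (a, c)) none = none := by simp [auxF]
theorem auxF_inl_some (a c x) : auxF g (Sum.inl (a, c)) (some x) = some (g 0 a x) := by
  simp [auxF]
theorem auxF_inr_none (t a i) : auxF g (Sum.inr (t, a, i)) none = some (g t.succ a i) := by
  simp [auxF]
theorem auxF_inr_some (t a i x) : auxF g (Sum.inr (t, a, i)) (some x) =
    if x = i then none else some (g t.succ a x) := by
  by_cases h : x = i
  · simp [auxF, h]
  · have : Equiv.swap none (some i) (some x) = some x :=
      Equiv.swap_apply_of_ne_of_ne (by simp) (by simpa using h)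
    simp [auxF, h, this]
end

theorem aux_perms {m : ℕ} (L : Fin (m + 1) → Fin (m + 2) → Fin (m + 2) → Fin (m + 2))
    (hL : IsMOLS L) : ∃ g : Fin (m + 1) → Fin (m + 2) → Equiv.Perm (Fin (m + 2)),
      ∀ s a x y, g s a x = y ↔ L s x y = a := by
  have h1 : ∀ s a, ∃ e : Equiv.Perm (Fin (m + 2)), ∀ x y, e x = y ↔ L s x y = a := by
    intro s a
    have hr := (hL.1 s).1
    have hc := (hL.1 s).2
    choose r hr1 hr2 using fun x => hr x a
    refine ⟨Equiv.ofBijective r ?_, ?_⟩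
    · rw [← Finite.injective_iff_bijective]
      intro x x' h
      exact (hc (r x) a).unique (hr1 x) (by rw [h]; exact hr1 x')
    · intro x y
      simp only [Equiv.ofBijective_apply]
      constructor
      · rintro rfl; exact hr1 x
      · intro h; exact (hr2 x y h).symm
  choose g hg using h1
  exact ⟨g, hg⟩

/-- unique line through two points -/
theorem aux_two {m : ℕ} (L : Fin (m + 1) → Fin (m + 2) → Fin (m + 2) → Fin (m + 2))
    (hL : IsMOLS L) (x y x' y' : Fin (m + 2)) (hx : x ≠ x') (hy : y ≠ y') :
    ∃! s, L s x y = L s x' y' := by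
  choose r hr1 hr2 using fun s => (hL.1 s).1 x' (L s x y)
  have hne : ∀ s, r s ≠ y := by
    intro s h
    have := hr1 s
    rw [h] at this
    exact hx (((hL.1 s).2 y (L s x y)).unique rfl this)
  have hinj : Function.Injective r := by
    intro s s' h
    by_contra hs
    have := (hL.2 s s' hs (L s x y) (L s' x y)).unique (y₁ := (x, y)) (y₂ := (x', r s))
      ⟨rfl, rfl⟩ ⟨hr1 s, by rw [h]; exact hr1 s'⟩
    exact hx (Prod.ext_iff.mp this).1
  let r' : Fin (m + 1) → {z : Fin (m + 2) // z ≠ y} := fun s => ⟨r s, hne s⟩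
  have hbij : Function.Bijective r' := by
    rw [Fintype.bijective_iff_injective_and_card]
    refine ⟨fun s s' h => hinj (congrArg Subtype.val h), ?_⟩
    simp [Fintype.card_subtype_compl]
  obtain ⟨s, hs⟩ := hbij.2 ⟨y', hy.symm⟩
  have hs' : r s = y' := congrArg Subtype.val hs
  refine ⟨s, ?_, ?_⟩
  · rw [← hs']; exact (hr1 s).symm
  · intro s' h
    exact hinj (by rw [hs', ← hr2 s' y' h.symm])

open Finset in
theorem aux_uniform {m : ℕ} (L : Fin (m + 1) → Fin (m + 2) → Fin (m + 2) → Fin (m + 2))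
    (hL : IsMOLS L) (g : Fin (m + 1) → Fin (m + 2) → Equiv.Perm (Fin (m + 2)))
    (hg : ∀ s a x y, g s a x = y ↔ L s x y = a)
    (x y x' y' : Option (Fin (m + 2))) (hx : x ≠ x') (hy : y ≠ y') :
    (univ.filter fun α : AuxT m => auxF g α x = y ∧ auxF g α x' = y').card = m := by
  have key : ∀ x y x' y' : Option (Fin (m + 2)),
    (univ.filter fun α : AuxT m => auxF g α x = y ∧ auxF g α x' = y').card =
     (∑ a, ∑ c, if auxF g (Sum.inl (a, c)) x = y ∧ auxF g (Sum.inl (a, c)) x' = y'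
        then 1 else 0) +
     ∑ t, ∑ a, ∑ i, if auxF g (Sum.inr (t, a, i)) x = y ∧ auxF g (Sum.inr (t, a, i)) x' = y'
        then 1 else 0 := by
    intro x y x' y'
    rw [Finset.card_filter, Fintype.sum_sum_type, Fintype.sum_prod_type, Fintype.sum_prod_type]
    simp only [Fintype.sum_prod_type]
  have c1 : ∀ x' y' : Fin (m + 2), (univ.filter fun α : AuxT m =>
      auxF g α none = none ∧ auxF g α (some x') = some y').card = m := by
    intro x' y'
    rw [key]
    simp [auxF_inl_none, auxF_inl_some, auxF_inr_none, hg]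
  have c2 : ∀ y x' : Fin (m + 2), (univ.filter fun α : AuxT m =>
      auxF g α none = some y ∧ auxF g α (some x') = none).card = m := by
    intro y x'
    rw [key]
    have : ∀ t a i, (auxF g (Sum.inr (t, a, i)) none = some y ∧
        auxF g (Sum.inr (t, a, i)) (some x') = none) ↔
        (L t.succ x' y = a ∧ i = x') := by
      intro t a i
      rw [auxF_inr_none, auxF_inr_some, ← hg]
      grind
    simp only [this]
    simp [auxF_inl_none, ite_and]
  have c3 : ∀ y x' y' : Fin (m + 2), y ≠ y' → (univ.filter fun α : AuxT m =>
      auxF g α none = some y ∧ auxF g α (some x') = some y').card = m := by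
    intro y x' y' hyy
    rw [key]
    have : ∀ t a i, (auxF g (Sum.inr (t, a, i)) none = some y ∧
        auxF g (Sum.inr (t, a, i)) (some x') = some y') ↔
        (L t.succ x' y' = a ∧ i = (g t.succ (L t.succ x' y')).symm y) := by
      intro t a i
      rw [auxF_inr_none, auxF_inr_some, ← hg]
      constructor
      · rintro ⟨h1, h2⟩
        split_ifs at h2 with h3
        have h2' : g t.succ a x' = y' := by simpa using h2
        refine ⟨h2', ?_⟩
        rw [(hg _ _ _ _).mp h2', Equiv.eq_symm_apply]
        simpa using h1
      · rintro ⟨h2, h1⟩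
        have h2' := h2
        rw [(hg _ _ _ _).mp h2, Equiv.eq_symm_apply] at h1
        refine ⟨by simpa using h1, ?_⟩
        have : x' ≠ i := by
          rintro rfl
          exact hyy (h1.symm.trans h2')
        simp [this, h2']
    simp only [this]
    simp [auxF_inl_none, ite_and]
  have c4 : ∀ x x' y' : Fin (m + 2), x ≠ x' → (univ.filter fun α : AuxT m =>
      auxF g α (some x) = none ∧ auxF g α (some x') = some y').card = m := by
    intro x x' y' hxx
    rw [key]
    have : ∀ t a i, (auxF g (Sum.inr (t, a, i)) (some x) = none ∧
        auxF g (Sum.inr (t, a, i)) (some x') = some y') ↔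
        (L t.succ x' y' = a ∧ i = x) := by
      intro t a i
      rw [auxF_inr_some, auxF_inr_some, ← hg]
      grind
    simp only [this]
    simp [auxF_inl_some, ite_and]
  have c5 : ∀ x y x' y' : Fin (m + 2), x ≠ x' → y ≠ y' → (univ.filter fun α : AuxT m =>
      auxF g α (some x) = some y ∧ auxF g α (some x') = some y').card = m := by
    intro x y x' y' hxx hyy
    rw [key]
    have e1 : ∀ t a, (∑ i, if auxF g (Sum.inr (t, a, i)) (some x) = some y ∧
        auxF g (Sum.inr (t, a, i)) (some x') = some y' then 1 else 0) =
        m * (if L t.succ x y = a ∧ L t.succ x' y' = a then 1 else 0) := by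
      intro t a
      have : ∀ i, (auxF g (Sum.inr (t, a, i)) (some x) = some y ∧
        auxF g (Sum.inr (t, a, i)) (some x') = some y') ↔
        ((L t.succ x y = a ∧ L t.succ x' y' = a) ∧ ¬ (i = x ∨ i = x')) := by
        intro i
        rw [auxF_inr_some, auxF_inr_some, ← hg, ← hg]
        grind
      simp only [this, ite_and]
      split_ifs
      · rw [← Finset.card_filter, Finset.filter_not, Finset.card_sdiff_of_subset (by simp)]
        have : (univ.filter fun i : Fin (m + 2) => i = x ∨ i = x') = {x, x'} := by
          ext; simp
        rw [this, Finset.card_pair hxx]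
        simp
      · simp
      · simp
    simp only [e1]
    have e2 : ∀ s, (∑ a, if L s x y = a ∧ L s x' y' = a then 1 else 0) =
        if L s x y = L s x' y' then 1 else 0 := by
      intro s
      simp [ite_and, eq_comm]
    simp only [← Finset.mul_sum, e2]
    have e3 : (∑ a, ∑ c : Fin m, if auxF g (Sum.inl (a, c)) (some x) = some y ∧
        auxF g (Sum.inl (a, c)) (some x') = some y' then 1 else 0) =
        m * if L 0 x y = L 0 x' y' then 1 else 0 := by
      rw [← e2]
      simp only [auxF_inl_some, Option.some_inj, hg, Finset.sum_const, Finset.card_univ,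
        Fintype.card_fin, smul_eq_mul, Finset.mul_sum]
    rw [e3, ← mul_add, ← Fin.sum_univ_succ (fun s => if L s x y = L s x' y' then 1 else 0),
      ← Finset.card_filter]
    obtain ⟨s, hs1, hs2⟩ := aux_two L hL x y x' y' hxx hyy
    have : (univ.filter fun s => L s x y = L s x' y') = {s} := by
      ext z
      simp only [mem_filter, mem_univ, true_and, mem_singleton]
      exact ⟨hs2 z, by rintro rfl; exact hs1⟩
    rw [this]; simp
  have flip : ∀ x y x' y' : Option (Fin (m + 2)),
      (univ.filter fun α : AuxT m => auxF g α x = y ∧ auxF g α x' = y').card =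
      (univ.filter fun α : AuxT m => auxF g α x' = y' ∧ auxF g α x = y).card := by
    intro x y x' y'
    simp only [and_comm]
  rcases x with _ | x <;> rcases x' with _ | x' <;> rcases y with _ | y <;> rcases y' with _ | y'
  all_goals try exact absurd rfl hx
  all_goals try exact absurd rfl hy
  all_goals simp only [ne_eq, Option.some_inj] at hx hy
  · exact c1 _ _
  · exact c2 _ _
  · exact c3 _ _ _ hy
  · rw [flip]; exact c2 _ _
  · rw [flip]; exact c1 _ _
  · rw [flip]; exact c3 _ _ _ (Ne.symm hy)
  · exact c4 _ _ _ hx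
  · rw [flip]; exact c4 _ _ _ (Ne.symm hx)
  · exact c5 _ _ _ _ hx hy

/-- concurrence -/
def auxC {m : ℕ} (g : Fin (m + 1) → Fin (m + 2) → Equiv.Perm (Fin (m + 2)))
    (α β : AuxT m) : ℕ :=
  (Finset.univ.filter fun x => auxF g α x = auxF g β x).card

section
open Finset
variable {m : ℕ} (g : Fin (m + 1) → Fin (m + 2) → Equiv.Perm (Fin (m + 2)))

theorem auxC_eq (α β : AuxT m) : auxC g α β =
    (if auxF g α none = auxF g β none then 1 else 0) +
      ∑ x, if auxF g α (some x) = auxF g β (some x) then 1 else 0 := by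
  unfold auxC
  rw [Finset.card_filter, Fintype.sum_option]

theorem auxC_comm (α β : AuxT m) : auxC g α β = auxC g β α := by
  unfold auxC
  simp only [eq_comm]

theorem auxC_AA (a c a' c') : auxC g (Sum.inl (a, c)) (Sum.inl (a', c')) =
    1 + (univ.filter fun x => g 0 a x = g 0 a' x).card := by
  rw [auxC_eq, Finset.card_filter]
  simp [auxF_inl_none, auxF_inl_some]

theorem auxC_AB (a c t b i) : auxC g (Sum.inl (a, c)) (Sum.inr (t, b, i)) =
    ((univ.filter fun x => g 0 a x = g t.succ b x).erase i).card := by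
  rw [auxC_eq, Finset.card_eq_sum_ones, ← Finset.filter_ne', Finset.filter_filter,
    Finset.sum_filter]
  simp only [auxF_inl_none, auxF_inl_some, auxF_inr_none, auxF_inr_some]
  rw [if_neg (by simp), zero_add]
  refine Finset.sum_congr rfl fun x _ => ?_
  congr 1
  grind

theorem auxC_BB (t b i t' b' i') : auxC g (Sum.inr (t, b, i)) (Sum.inr (t', b', i')) =
    (if g t.succ b i = g t'.succ b' i' then 1 else 0) + (if i = i' then 1 else 0) +
    (((univ.filter fun x => g t.succ b x = g t'.succ b' x).erase i).erase i').card := by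
  rw [auxC_eq, Finset.card_eq_sum_ones, ← Finset.filter_ne', ← Finset.filter_ne',
    Finset.filter_filter, Finset.filter_filter, Finset.sum_filter]
  simp only [auxF_inr_none, auxF_inr_some, Option.some_inj, add_assoc]
  congr 1
  have : (if i = i' then 1 else 0) = ∑ x, if x = i ∧ i = i' then 1 else 0 := by
    simp [ite_and]
  rw [this, ← Finset.sum_add_distrib]
  refine Finset.sum_congr rfl fun x _ => ?_
  grind

variable (L : Fin (m + 1) → Fin (m + 2) → Fin (m + 2) → Fin (m + 2)) (hL : IsMOLS L)
    (hg : ∀ s a x y, g s a x = y ↔ L s x y = a)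

include hL hg in
theorem aux_agree_ne {s s'} (h : s ≠ s') (a a') :
    ∃ p, ∀ x, g s a x = g s' a' x ↔ x = p := by
  obtain ⟨⟨p, q⟩, ⟨h1, h2⟩, h3⟩ := hL.2 s s' h a a'
  refine ⟨p, fun x => ⟨fun hx => ?_, ?_⟩⟩
  · have h4 := (hg s' a' x _).mp hx.symm
    have h5 := (hg s a x _).mp rfl
    exact (Prod.ext_iff.mp (h3 (x, g s a x) ⟨h5, h4⟩)).1
  · rintro rfl
    rw [(hg s a x q).mpr h1, (hg s' a' x q).mpr h2]

include hg in
theorem aux_agree_same {s a a'} (h : a ≠ a') (x) : g s a x ≠ g s a' x := by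
  intro hx
  exact h (((hg s a x _).mp rfl).symm.trans ((hg s a' x _).mp hx.symm))

theorem aux_sum_ite {N : ℕ} (a : Fin N) (u v : ℚ) :
    (∑ x : Fin N, if x = a then u else v) = u + (N - 1) * v := by
  have : ∀ x : Fin N, (if x = a then u else v) = v + if x = a then u - v else 0 := by
    intro x; split_ifs <;> ring
  simp only [this, Finset.sum_add_distrib]
  simp
  ring

include hg in
theorem aux_sum_AA (h : ℕ → ℚ) (a c) :
    ∑ a', ∑ c', h (auxC g (Sum.inl (a, c)) (Sum.inl (a', c'))) =
      m * h (m + 3) + (m + 1) * m * h 1 := by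
  have : ∀ a' c', h (auxC g (Sum.inl (a, c)) (Sum.inl (a', c'))) =
      if a' = a then h (m + 3) else h 1 := by
    intro a' c'
    rw [auxC_AA]
    split_ifs with e
    · subst e
      simp [add_left_comm]
    · rw [Finset.filter_false_of_mem]
      · simp
      · intro x _
        exact aux_agree_same g L hg (Ne.symm e) x
  simp only [this, Finset.sum_const, Finset.card_univ, Fintype.card_fin, nsmul_eq_mul,
    ← Finset.mul_sum, aux_sum_ite]
  push_cast; ring

include hL hg in
theorem aux_sum_AB (h : ℕ → ℚ) (a c t b) :
    ∑ i, h (auxC g (Sum.inl (a, c)) (Sum.inr (t, b, i))) = h 0 + (m + 1) * h 1 := by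
  obtain ⟨p, hp⟩ := aux_agree_ne g L hL hg (Fin.succ_ne_zero t).symm a b
  have : ∀ i, h (auxC g (Sum.inl (a, c)) (Sum.inr (t, b, i))) =
      if i = p then h 0 else h 1 := by
    intro i
    rw [auxC_AB]
    simp only [hp]
    rw [Finset.filter_eq' univ p, if_pos (mem_univ _)]
    split_ifs with e
    · subst e; simp
    · rw [Finset.erase_eq_of_notMem (by simpa using e)]; simp
  simp only [this, aux_sum_ite]
  push_cast; ring

theorem aux_sum_BB_same (h : ℕ → ℚ) (t b i) :
    ∑ i', h (auxC g (Sum.inr (t, b, i)) (Sum.inr (t, b, i'))) = h (m + 3) + (m + 1) * h m := by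
  have : ∀ i', h (auxC g (Sum.inr (t, b, i)) (Sum.inr (t, b, i'))) =
      if i' = i then h (m + 3) else h m := by
    intro i'
    rw [auxC_BB]
    by_cases e : i' = i
    · subst e
      simp [Finset.card_erase_of_mem]
      congr 1; omega
    · have e' : i ≠ i' := Ne.symm e
      simp [Finset.card_erase_of_mem, e, e']
  simp only [this, aux_sum_ite]
  push_cast; ring

include hg in
theorem aux_sum_BB_par (h : ℕ → ℚ) (t b i b') (hb : b' ≠ b) :
    ∑ i', h (auxC g (Sum.inr (t, b, i)) (Sum.inr (t, b', i'))) = 2 * h 1 + m * h 0 := by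
  have hE : (univ.filter fun x => g t.succ b x = g t.succ b' x) = ∅ := by
    rw [Finset.filter_false_of_mem]
    intro x _
    exact aux_agree_same g L hg (Ne.symm hb) x
  set q := (g t.succ b').symm (g t.succ b i) with hq
  have hqi : ∀ i', g t.succ b i = g t.succ b' i' ↔ i' = q := by
    intro i'; rw [hq, Equiv.eq_symm_apply, eq_comm]
  have hne : i ≠ q := by
    intro e
    exact aux_agree_same g L hg (Ne.symm hb) i ((hqi i).mpr e)
  have : ∀ i', h (auxC g (Sum.inr (t, b, i)) (Sum.inr (t, b', i'))) =
      h 0 + (if i' = i then h 1 - h 0 else 0) + (if i' = q then h 1 - h 0 else 0) := by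
    intro i'
    rw [auxC_BB, hE]
    simp only [hqi, Finset.erase_empty, Finset.card_empty, eq_comm (a := i)]
    by_cases e1 : i' = i <;> by_cases e2 : i' = q
    · exact absurd (e1.symm.trans e2) hne
    · simp [e1, hne]
    · simp [e2, hne.symm]
    · simp [e1, e2]
  simp only [this, Finset.sum_add_distrib, Finset.sum_ite_eq', Finset.mem_univ, if_true,
    Finset.sum_const, Finset.card_univ, Fintype.card_fin, nsmul_eq_mul]
  push_cast; ring

include hL hg in
theorem aux_sum_BB_ne (h : ℕ → ℚ) (t b i t') (ht : t' ≠ t) (b') :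
    ∑ i', h (auxC g (Sum.inr (t, b, i)) (Sum.inr (t', b', i'))) =
      if b' = L t'.succ i (g t.succ b i) then h 2 + (m + 1) * h 0
      else 2 * h 2 + h 0 + (m - 1) * h 1 := by
  obtain ⟨p, hp⟩ := aux_agree_ne g L hL hg
    (fun e => ht (Fin.succ_injective _ e).symm : t.succ ≠ t'.succ) b b'
  have hpi : b' = L t'.succ i (g t.succ b i) ↔ i = p := by
    rw [← hp, eq_comm, ← hg, eq_comm]
  simp only [hpi]
  set q := (g t'.succ b').symm (g t.succ b i) with hq
  have hqi : ∀ i', g t.succ b i = g t'.succ b' i' ↔ i' = q := by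
    intro i'; rw [hq, Equiv.eq_symm_apply, eq_comm]
  have hiq : i = q ↔ i = p := by rw [← hqi, hp]
  have hpq : p = q ↔ i = p := by
    rw [← hqi, ← (hp p).mpr rfl]
    exact (g t.succ b).injective.eq_iff
  have hC : ∀ i', auxC g (Sum.inr (t, b, i)) (Sum.inr (t', b', i')) =
      (if i' = q then 1 else 0) + (if i' = i then 1 else 0) +
        (if i = p ∨ i' = p then 0 else 1) := by
    intro i'
    rw [auxC_BB]
    simp only [hqi, hp, eq_comm (a := i) (b := i')]
    rw [Finset.filter_eq' univ p, if_pos (mem_univ _)]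
    congr 1
    by_cases e1 : i = p
    · simp [e1]
    · rw [Finset.erase_eq_of_notMem (s := {p}) (a := i) (by simpa using e1)]
      by_cases e2 : i' = p
      · simp [e2]
      · rw [Finset.erase_eq_of_notMem (s := {p}) (a := i') (by simpa using e2)]
        simp [e1, e2]
  split_ifs with e
  · have hq' : i = q := hiq.mpr e
    have : ∀ i', h (auxC g (Sum.inr (t, b, i)) (Sum.inr (t', b', i'))) =
        if i' = i then h 2 else h 0 := by
      intro i'
      rw [hC, ← hq']
      by_cases e1 : i' = i
      · simp [e1, e]
      · simp only [e1, if_false]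
        simp [e]
    simp only [this, aux_sum_ite]
    push_cast; ring
  · have n1 : i ≠ q := fun e' => e (hiq.mp e')
    have n2 : p ≠ q := fun e' => e (hpq.mp e')
    have : ∀ i', h (auxC g (Sum.inr (t, b, i)) (Sum.inr (t', b', i'))) =
        h 1 + (if i' = i then h 2 - h 1 else 0) + (if i' = q then h 2 - h 1 else 0) +
          (if i' = p then h 0 - h 1 else 0) := by
      intro i'
      rw [hC]
      by_cases e1 : i' = i
      · have e2 : i' ≠ q := by rw [e1]; exact n1
        have e3 : i' ≠ p := by rw [e1]; exact e
        simp [e1, n1, e]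
      · by_cases e2 : i' = q
        · simp [e2, e, n1.symm, n2.symm]
        · by_cases e3 : i' = p
          · simp [e3, Ne.symm e, n2]
          · simp [e1, e2, e3, e]
    simp only [this, Finset.sum_add_distrib, Finset.sum_ite_eq', Finset.mem_univ, if_true,
      Finset.sum_const, Finset.card_univ, Fintype.card_fin, nsmul_eq_mul]
    push_cast; ring

include hL hg in
theorem aux_sum_BB (h : ℕ → ℚ) (t b i) :
    ∑ t', ∑ b', ∑ i', h (auxC g (Sum.inr (t, b, i)) (Sum.inr (t', b', i'))) =
      (h (m + 3) + (m + 1) * h m) + (m + 1) * (2 * h 1 + m * h 0) +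
      (m - 1) * ((h 2 + (m + 1) * h 0) + (m + 1) * (2 * h 2 + h 0 + (m - 1) * h 1)) := by
  have : ∀ t', ∑ b', ∑ i', h (auxC g (Sum.inr (t, b, i)) (Sum.inr (t', b', i'))) =
      if t' = t then (h (m + 3) + (m + 1) * h m) + (m + 1) * (2 * h 1 + m * h 0) else
      ((h 2 + (m + 1) * h 0) + (m + 1) * (2 * h 2 + h 0 + (m - 1) * h 1)) := by
    intro t'
    split_ifs with e
    · subst e
      have : ∀ b', ∑ i', h (auxC g (Sum.inr (t', b, i)) (Sum.inr (t', b', i'))) =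
          if b' = b then h (m + 3) + (m + 1) * h m else 2 * h 1 + m * h 0 := by
        intro b'
        split_ifs with e
        · subst e; exact aux_sum_BB_same g h _ _ _
        · exact aux_sum_BB_par g L hg h _ _ _ _ e
      simp only [this, aux_sum_ite]
      push_cast; ring
    · simp only [aux_sum_BB_ne g L hL hg h t b i t' e, aux_sum_ite]
      push_cast; ring
  simp only [this, aux_sum_ite]

include hL hg in
theorem aux_total (h : ℕ → ℚ) :
    ∑ α, ∑ β, h (auxC g α β) =
      (m + 2) * m * (m * h (m + 3) + (m + 1) * m * h 1) +
      2 * (((m + 2) * m) ^ 2 * (h 0 + (m + 1) * h 1)) +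
      m * (m + 2) ^ 2 * ((h (m + 3) + (m + 1) * h m) + (m + 1) * (2 * h 1 + m * h 0) +
      (m - 1) * ((h 2 + (m + 1) * h 0) + (m + 1) * (2 * h 2 + h 0 + (m - 1) * h 1))) := by
  have hBA : ∑ x : Fin m × Fin (m + 2) × Fin (m + 2), ∑ y : Fin (m + 2) × Fin m,
      h (auxC g (Sum.inr x) (Sum.inl y)) = ∑ y : Fin (m + 2) × Fin m,
      ∑ x : Fin m × Fin (m + 2) × Fin (m + 2), h (auxC g (Sum.inl y) (Sum.inr x)) := by
    rw [Finset.sum_comm]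
    refine Finset.sum_congr rfl fun x _ => Finset.sum_congr rfl fun y _ => ?_
    rw [auxC_comm]
  simp only [Fintype.sum_sum_type, Finset.sum_add_distrib]
  rw [hBA]
  simp only [Fintype.sum_prod_type, aux_sum_AA g L hg, aux_sum_AB g L hL hg,
    aux_sum_BB g L hL hg, Finset.sum_const, Finset.card_univ, Fintype.card_fin, Fintype.card_prod, nsmul_eq_mul]
  push_cast; ring

include hL hg in
theorem aux_eta_count (k : ℕ) (h : ℕ → ℚ) (hh : h = fun j => if j = k then 1 else 0) :
    ((univ.filter fun p : AuxT m × AuxT m => p.1 ≠ p.2 ∧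
      (univ.filter fun x => auxF g p.1 x = auxF g p.2 x).card = k).card : ℚ) =
      (m + 2) * m * (m * h (m + 3) + (m + 1) * m * h 1) +
      2 * (((m + 2) * m) ^ 2 * (h 0 + (m + 1) * h 1)) +
      m * (m + 2) ^ 2 * ((h (m + 3) + (m + 1) * h m) + (m + 1) * (2 * h 1 + m * h 0) +
      (m - 1) * ((h 2 + (m + 1) * h 0) + (m + 1) * (2 * h 2 + h 0 + (m - 1) * h 1))) -
      (m + 3) * (m * (m + 2)) * h (m + 3) := by
  rw [← aux_total g L hL hg h, Finset.card_filter, Fintype.sum_prod_type]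
  push_cast
  have hd : ∀ α : AuxT m, h (auxC g α α) = h (m + 3) := by
    intro α; unfold auxC; simp
  have : ∀ α β : AuxT m, (if α ≠ β ∧
      (univ.filter fun x => auxF g α x = auxF g β x).card = k then (1 : ℚ) else 0) =
      h (auxC g α β) - if α = β then h (m + 3) else 0 := by
    intro α β
    by_cases e : α = β
    · subst e; simp [hd]
    · simp only [ne_eq, e, not_false_eq_true, true_and, if_false, sub_zero]
      rw [hh]; rfl
  simp only [this, Finset.sum_sub_distrib, Finset.sum_ite_eq, Finset.mem_univ, if_true,
    Finset.sum_const, Finset.card_univ, nsmul_eq_mul]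
  congr 2
  simp
  ring
end

/-- Theorem 7: if `n ≥ 5` and `n − 1` MOLS of order `n` exist, then there is a uniform
`((n+1)×(n+1))/((n−2)n)` semi-Latin square `S̄` with
`η_{n+1} = n(n−2)(n−3)/2`, `η_{n−2} = n²(n−1)(n−2)/2`, `η₂ = n²(n−2)(n−3)(2n−1)/2`,
`η₁ = n(n−1)(n−2)(n³−4n²+8n−2)/2`, `η₀ = n²(n−2)(3n²−9n+4)/2`, and `η_m = 0` for all
other non-negative integers `m`. -/
theorem eta_of_uniform_sls_n_plus_one (n : ℕ) (hn : 5 ≤ n)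
    (L : Fin (n - 1) → Fin n → Fin n → Fin n) (hL : IsMOLS L) :
    ∃ S : SemiLatinSquare (n + 1) ((n - 2) * n), S.IsUniform ∧
      (S.eta (n + 1) : ℚ) = (n : ℚ) * ((n : ℚ) - 2) * ((n : ℚ) - 3) / 2 ∧
      (S.eta (n - 2) : ℚ) = (n : ℚ) ^ 2 * ((n : ℚ) - 1) * ((n : ℚ) - 2) / 2 ∧
      (S.eta 2 : ℚ)
        = (n : ℚ) ^ 2 * ((n : ℚ) - 2) * ((n : ℚ) - 3) * (2 * (n : ℚ) - 1) / 2 ∧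
      (S.eta 1 : ℚ) = (n : ℚ) * ((n : ℚ) - 1) * ((n : ℚ) - 2)
        * ((n : ℚ) ^ 3 - 4 * (n : ℚ) ^ 2 + 8 * (n : ℚ) - 2) / 2 ∧
      (S.eta 0 : ℚ)
        = (n : ℚ) ^ 2 * ((n : ℚ) - 2) * (3 * (n : ℚ) ^ 2 - 9 * (n : ℚ) + 4) / 2 ∧
      ∀ m : ℕ, m ∉ ({0, 1, 2, n - 2, n + 1} : Set ℕ) → S.eta m = 0 := by
  obtain ⟨m, rfl⟩ : ∃ m, n = m + 2 := ⟨n - 2, by omega⟩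
  have hm : 3 ≤ m := by omega
  obtain ⟨g, hg⟩ := aux_perms (m := m) L hL
  obtain ⟨S, hS, hη⟩ := aux_transport (P := Option (Fin (m + 2))) (T := AuxT m)
    (m + 2 + 1) ((m + 2 - 2) * (m + 2)) m (by simp)
    (by simp; ring) (by omega)
    (by rw [Nat.add_sub_cancel, Nat.add_sub_cancel, mul_comm]) (by omega) (auxF g) (aux_uniform (m := m) L hL g hg)
  have key : ∀ (k : ℕ) (a0 a1 a2 am an : ℚ), (if 0 = k then 1 else 0) = a0 →
      (if 1 = k then 1 else 0) = a1 → (if 2 = k then 1 else 0) = a2 →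
      (if m = k then 1 else 0) = am → (if m + 3 = k then 1 else 0) = an →
      (S.eta k : ℚ) = ((m + 2) * m * (m * an + (m + 1) * m * a1) +
      2 * (((m + 2) * m) ^ 2 * (a0 + (m + 1) * a1)) +
      m * (m + 2) ^ 2 * ((an + (m + 1) * am) + (m + 1) * (2 * a1 + m * a0) +
      (m - 1) * ((a2 + (m + 1) * a0) + (m + 1) * (2 * a2 + a0 + (m - 1) * a1))) -
      (m + 3) * (m * (m + 2)) * an) / 2 := by
    intro k a0 a1 a2 am an h0 h1 h2 h3 h4
    have h5 := aux_eta_count g L hL hg k _ rfl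
    rw [← hη k] at h5
    simp only [h0, h1, h2, h3, h4] at h5
    push_cast at h5
    rw [← h5]; ring
  refine ⟨S, hS, ?_, ?_, ?_, ?_, ?_, ?_⟩
  · rw [key _ 0 0 0 0 1 (if_neg (by omega)) (if_neg (by omega)) (if_neg (by omega))
      (if_neg (by omega)) (if_pos (by omega))]
    push_cast; ring
  · rw [key _ 0 0 0 1 0 (if_neg (by omega)) (if_neg (by omega)) (if_neg (by omega))
      (if_pos (by omega)) (if_neg (by omega))]
    push_cast; ring
  · rw [key _ 0 0 1 0 0 (if_neg (by omega)) (if_neg (by omega)) (if_pos (by omega))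
      (if_neg (by omega)) (if_neg (by omega))]
    push_cast; ring
  · rw [key _ 0 1 0 0 0 (if_neg (by omega)) (if_pos (by omega)) (if_neg (by omega))
      (if_neg (by omega)) (if_neg (by omega))]
    push_cast; ring
  · rw [key _ 1 0 0 0 0 (if_pos (by omega)) (if_neg (by omega)) (if_neg (by omega))
      (if_neg (by omega)) (if_neg (by omega))]
    push_cast; ring
  · intro k hk
    simp only [Set.mem_insert_iff, Set.mem_singleton_iff, not_or] at hk
    obtain ⟨k0, k1, k2, k3, k4⟩ := hk
    have : (S.eta k : ℚ) = 0 := by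
      rw [key _ 0 0 0 0 0 (if_neg (by omega)) (if_neg (by omega)) (if_neg (by omega))
        (if_neg (by omega)) (if_neg (by omega))]
      ring
    exact_mod_cast this
end

section
/- Let n > 2 be a prime power. Then for every positive integer μ with μ ≥ (n−3)(n−2), there exists a uniform ((n+1)×(n+1))/(μn) semi-Latin square; moreover, if n is odd, then for every positive integer μ with μ ≥ (n−3)((n−1)/2 − 1), there exists a uniform ((n+1)×(n+1))/(μn) semi-Latin square. -/
open Polynomial

open Finset in
def UW (X : Type) [Fintype X] [DecidableEq X] (μ : ℕ) : Prop :=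
  ∃ w : (X → X) → ℕ, (∀ f, w f ≠ 0 → Function.Injective f) ∧
    ∀ i i' j j' : X, i ≠ i' → j ≠ j' →
      ∑ f ∈ univ.filter (fun f : X → X => f i = j ∧ f i' = j'), w f = μ

theorem UW.add {X : Type} [Fintype X] [DecidableEq X] {μ ν : ℕ} (h : UW X μ) (k : UW X ν)
    (a b : ℕ) : UW X (a * μ + b * ν) := by
  obtain ⟨w, hw, h⟩ := h
  obtain ⟨v, hv, k⟩ := k
  refine ⟨fun f => a * w f + b * v f, ?_, ?_⟩
  · intro f hf
    by_cases h0 : w f = 0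
    · by_cases h1 : v f = 0
      · simp [h0, h1] at hf
      · exact hv f h1
    · exact hw f h0
  · intro i i' j j' hi hj
    rw [Finset.sum_add_distrib, ← Finset.mul_sum, ← Finset.mul_sum, h i i' j j' hi hj,
      k i i' j j' hi hj]

theorem fam_sum {X T : Type} [Fintype X] [DecidableEq X] (s : Finset T) (p : T → X → X)
    (Q : (X → X) → Prop) [DecidablePred Q] :
    ∑ f ∈ Finset.univ.filter Q, (s.filter (fun t => p t = f)).card
      = (s.filter (fun t => Q (p t))).card := by
  rw [Finset.card_eq_sum_card_fiberwise (f := p) (t := Finset.univ.filter Q)]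
  · apply Finset.sum_congr rfl
    intro f hf
    congr 1
    ext t
    simp only [Finset.mem_filter, Finset.mem_univ, true_and] at *
    constructor
    · rintro ⟨h1, h2⟩
      exact ⟨⟨h1, h2 ▸ hf⟩, h2⟩
    · rintro ⟨⟨h1, _⟩, h2⟩
      exact ⟨h1, h2⟩
  · intro t ht
    simpa using (Finset.mem_filter.1 ht).2

/-- Two families, the second repeated `m` times. -/
theorem UW.of_fam {F T U : Type} [Fintype F] [DecidableEq F] (μ m : ℕ)
    (s : Finset T) (p : T → Option F → Option F) (hp : ∀ t ∈ s, Function.Injective (p t))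
    (u : Finset U) (q : U → Option F → Option F) (hq : ∀ t ∈ u, Function.Injective (q t))
    (C : Option F → Option F → Option F → Option F → ℕ)
    (hC : ∀ i i' j j', C i i' j j' = (s.filter (fun t => p t i = j ∧ p t i' = j')).card
      + m * (u.filter (fun t => q t i = j ∧ q t i' = j')).card)
    (h1 : ∀ x y, C none (some x) none (some y) = μ)
    (h2 : ∀ x y, C none (some x) (some y) none = μ)
    (h3 : ∀ c x y, y ≠ c → C none (some x) (some c) (some y) = μ)
    (h4 : ∀ d x y, x ≠ d → C (some d) (some x) none (some y) = μ)
    (h5 : ∀ x x' y y', x ≠ x' → y ≠ y' → C (some x) (some x') (some y) (some y') = μ) :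
    UW (Option F) μ := by
  have hs : ∀ i i' j j', C i i' j j' = C i' i j' j := by
    intro i i' j j'
    rw [hC, hC]
    congr 2
    · congr 1; ext t; rw [and_comm]
    · congr 2; ext t; rw [and_comm]
  refine ⟨fun f => (s.filter (fun t => p t = f)).card + m * (u.filter (fun t => q t = f)).card,
    ?_, ?_⟩
  · intro f hf
    by_cases h0 : (s.filter (fun t => p t = f)).card = 0
    · by_cases h1 : (u.filter (fun t => q t = f)).card = 0
      · simp only [h0, h1] at hf; simp at hf
      · obtain ⟨t, ht⟩ := Finset.card_pos.1 (Nat.pos_of_ne_zero h1)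
        rw [Finset.mem_filter] at ht
        exact ht.2 ▸ hq t ht.1
    · obtain ⟨t, ht⟩ := Finset.card_pos.1 (Nat.pos_of_ne_zero h0)
      rw [Finset.mem_filter] at ht
      exact ht.2 ▸ hp t ht.1
  · intro i i' j j' hi hj
    rw [Finset.sum_add_distrib, ← Finset.mul_sum, fam_sum s p (fun f => f i = j ∧ f i' = j'),
      fam_sum u q (fun f => f i = j ∧ f i' = j'), ← hC]
    rcases i with _ | i <;> rcases i' with _ | i' <;> rcases j with _ | j <;>
      rcases j' with _ | j' <;> simp only [ne_eq, not_true_eq_false] at hi hj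
    · exact h1 _ _
    · exact h2 _ _
    · exact h3 _ _ _ (by simpa [eq_comm] using hj)
    · rw [hs]; exact h2 _ _
    · rw [hs]; exact h1 _ _
    · rw [hs]; exact h3 _ _ _ (by simpa using hj)
    · exact h4 _ _ _ (by simpa [eq_comm] using hi)
    · rw [hs]; exact h4 _ _ _ (by simpa using hi)
    · exact h5 _ _ _ _ (by simpa using hi) (by simpa using hj)

theorem UW.toSLS {X : Type} [Fintype X] [DecidableEq X] {μ n : ℕ} (hn : 0 < n) (hμ : 0 < μ)
    (hX : Fintype.card X = n + 1) (h : UW X μ) :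
    ∃ S : SemiLatinSquare (n + 1) (μ * n), S.IsUniform := by
  obtain ⟨w, hw, h⟩ := h
  have hc : ∀ i j : X, ∑ f ∈ Finset.univ.filter (fun f : X → X => f i = j), w f = μ * n := by
    intro i j
    obtain ⟨i', hi'⟩ : ∃ i', i ≠ i' := by
      have : Nontrivial X := Fintype.one_lt_card_iff_nontrivial.1 (by omega)
      obtain ⟨k, hk⟩ := exists_ne i
      exact ⟨k, hk.symm⟩
    rw [← Finset.sum_fiberwise (Finset.univ.filter (fun f : X → X => f i = j)) (fun f => f i') w,
      ← Finset.add_sum_erase _ _ (Finset.mem_univ j)]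
    have h0 : ∑ f ∈ (Finset.univ.filter (fun f : X → X => f i = j)).filter
        (fun f => f i' = j), w f = 0 := by
      apply Finset.sum_eq_zero
      intro f hf
      simp only [Finset.mem_filter, Finset.mem_univ, true_and] at hf
      by_contra h1
      exact hi' (hw f h1 (hf.1.trans hf.2.symm))
    rw [h0, zero_add, Finset.sum_congr rfl (g := fun _ => μ)]
    · rw [Finset.sum_const, Finset.card_erase_of_mem (Finset.mem_univ _), Finset.card_univ, hX]
      simp [mul_comm]
    · intro j' hj'
      rw [Finset.filter_filter]
      exact h i i' j j' hi' (Finset.ne_of_mem_erase hj').symm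
  have hcard : Fintype.card (Σ f : X → X, Fin (w f)) = (n + 1) * (μ * n) := by
    have i : X := (Fintype.card_pos_iff.1 (by omega : 0 < Fintype.card X)).some
    rw [Fintype.card_sigma, ← Finset.sum_fiberwise Finset.univ (fun f : X → X => f i),
      Finset.sum_congr rfl (g := fun _ => μ * n)]
    · simp [hX]
    · intro j _
      simpa using hc i j
  let e : (Σ f : X → X, Fin (w f)) ≃ Fin ((n + 1) * (μ * n)) := Fintype.equivFinOfCardEq hcard
  let x : X ≃ Fin (n + 1) := Fintype.equivFinOfCardEq hX
  have key : ∀ (Q : (X → X) → Prop) [DecidablePred Q],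
      (Finset.univ.filter (fun α => Q (e.symm α).1)).card
        = ∑ f ∈ Finset.univ.filter Q, w f := by
    intro Q _
    have : Finset.univ.filter (fun α => Q (e.symm α).1) =
      ((Finset.univ.filter Q).sigma (fun f => (Finset.univ : Finset (Fin (w f))))).map
        e.toEmbedding := by
      ext α
      simp only [Finset.mem_filter, Finset.mem_univ, true_and, Finset.mem_map,
        Finset.mem_sigma, and_true, Equiv.coe_toEmbedding]
      constructor
      · intro hα
        exact ⟨e.symm α, hα, by simp⟩
      · rintro ⟨t, ht, rfl⟩
        simpa using ht
    rw [this, Finset.card_map, Finset.card_sigma]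
    simp
  have hinj : ∀ α, Function.Injective (e.symm α).1 := by
    intro α
    apply hw
    have := (e.symm α).2.pos
    omega
  refine ⟨⟨fun i j => Finset.univ.filter (fun α => (e.symm α).1 (x.symm i) = x.symm j), ?_, ?_, ?_⟩,
    μ, hμ, ?_⟩
  · intro i j
    rw [key (fun f => f (x.symm i) = x.symm j), hc]
  · intro i α
    refine ⟨x ((e.symm α).1 (x.symm i)), by simp, ?_⟩
    intro j hj
    simp only [Finset.mem_filter, Finset.mem_univ, true_and] at hj
    rw [hj]; simp
  · intro j α
    obtain ⟨a, ha⟩ := (Finite.injective_iff_surjective.1 (hinj α)) (x.symm j)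
    refine ⟨x a, by simp [ha], ?_⟩
    intro i hi
    simp only [Finset.mem_filter, Finset.mem_univ, true_and] at hi
    have := hinj α (hi.trans ha.symm)
    rw [← this]; simp
  · intro i j i' j' hi hj
    simp only
    rw [← Finset.filter_and,
      key (fun f => f (x.symm i) = x.symm j ∧ f (x.symm i') = x.symm j')]
    exact h _ _ _ _ (by simpa using hi) (by simpa using hj)

section fams
variable {F : Type} [Field F] [DecidableEq F]

def affF (t : F × F) : Option F → Option F
  | none => none
  | some x => some (t.1 * x + t.2)

def invF (t : F × F × F) : Option F → Option F
  | none => some t.2.1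
  | some x => if x = t.2.2 then none else some (t.2.1 + t.1 / (x - t.2.2))

def proF (t : F × F × F) : Option F → Option F
  | none => some (t.1 * t.2.2 + t.2.1)
  | some x => if x = t.2.2 then none else some (t.1 * x + t.2.1)

theorem affF_inj (t : F × F) (h : t.1 ≠ 0) : Function.Injective (affF t) := by
  rintro (_ | x) (_ | y) <;> simp [affF, h]

theorem invF_inj (t : F × F × F) (h : t.1 ≠ 0) : Function.Injective (invF t) := by
  obtain ⟨a, c, d⟩ := t
  simp only at h
  rintro (_ | x) (_ | y) <;> simp only [invF]
  · simp
  · split_ifs with h1 <;> simp [h, sub_eq_zero, h1]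
  · split_ifs with h1 <;> simp [h, sub_eq_zero, h1]
  · split_ifs with h1 h2 h2
    · simp [h1, h2]
    · simp
    · simp
    · have h3 := sub_ne_zero.2 h1
      have h4 := sub_ne_zero.2 h2
      simp only [Option.some.injEq, add_right_inj]
      intro h5
      rw [div_eq_div_iff h3 h4] at h5
      have := mul_left_cancel₀ h h5
      linear_combination -this

theorem proF_inj (t : F × F × F) (h : t.1 ≠ 0) : Function.Injective (proF t) := by
  obtain ⟨a, c, d⟩ := t
  simp only at h
  rintro (_ | x) (_ | y) <;> simp only [proF]
  · simp
  · split_ifs with h1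
    · simp
    · simp [h, Ne.symm h1]
  · split_ifs with h1 <;> simp [h, h1]
  · split_ifs with h1 h2 h2 <;> simp [h, h1, h2]

variable [Fintype F]

theorem UW_inv (P : F → Prop) [DecidablePred P] (r : ℕ) (h0 : ¬ P 0)
    (hP : ∀ a b, b ≠ 0 → (P (a * b ^ 2) ↔ P a))
    (hr : (Finset.univ.filter P).card = r) : UW (Option F) r := by
  have hr' : (Finset.univ.filter (fun a => P (-a))).card = r := by
    rw [← hr]
    exact Finset.card_nbij' (fun a => -a) (fun a => -a) (by intro a; simp) (by intro a; simp)
      (by intro a; simp) (by intro a; simp)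
  refine UW.of_fam r 1 (Finset.univ.filter (fun t : F × F × F => P (-t.1))) invF ?_
    (Finset.univ.filter (fun t : F × F => P t.1)) affF ?_ _ (fun _ _ _ _ => rfl) ?_ ?_ ?_ ?_ ?_
  · intro t ht
    apply invF_inj
    intro h
    simp [h, h0] at ht
  · intro t ht
    apply affF_inj
    intro h
    simp [h, h0] at ht
  · intro x y
    simp only [Finset.filter_filter]
    simp only [invF, affF, reduceCtorEq, false_and, and_false, Finset.filter_false, true_and,
      Finset.card_empty, zero_add, one_mul, Option.some.injEq]
    rw [← hr]
    exact Finset.card_nbij' (fun t => t.1) (fun a => (a, y - a * x)) (by intro t; simp; tauto)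
      (by intro t; simp) (by intro t; simp; intro _ h; ext <;> simp [← h]) (by intro t; simp)
  · intro x y
    simp only [Finset.filter_filter]
    simp only [invF, affF, reduceCtorEq, false_and, and_false, Finset.filter_false,
      Finset.card_empty, mul_zero, add_zero, Option.some.injEq, ite_eq_left_iff, imp_false, not_not]
    rw [← hr']
    exact Finset.card_nbij' (fun t => t.1) (fun a => (a, y, x)) (by intro t; simp; tauto)
      (by intro t; simp) (by intro t; simp; intro _ h h'; ext <;> simp [← h, h'])
      (by intro t; simp)
  · intro c x y hy
    have hy' := sub_ne_zero.2 hy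
    simp only [Finset.filter_filter]
    simp only [invF, affF, reduceCtorEq, false_and, and_false, Finset.filter_false,
      Finset.card_empty, mul_zero, add_zero, Option.some.injEq, ite_eq_iff, false_or]
    rw [← hr']
    refine Finset.card_nbij' (fun t => t.1) (fun a => (a, c, x - a / (y - c)))
      (by intro t; simp; tauto) ?_ ?_ (by intro t; simp)
    · intro a
      simp only [Finset.coe_filter, Finset.mem_univ, true_and, Set.mem_ofPred_eq]
      intro ha
      have ha0 : a ≠ 0 := by rintro rfl; simp [h0] at ha
      refine ⟨ha, ?_, ?_⟩
      · intro h
        have : a / (y - c) = 0 := by linear_combination h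
        simp [ha0, hy'] at this
      · have : x - (x - a / (y - c)) = a / (y - c) := by ring
        rw [this]; field_simp; ring
    · rintro ⟨a, c', d⟩
      simp only [Finset.coe_filter, Finset.mem_univ, true_and, Set.mem_ofPred_eq]
      rintro ⟨_, rfl, h2, h3⟩
      have h2 := sub_ne_zero.2 h2
      have h4 : a = (y - c') * (x - d) := by rw [← h3]; field_simp; ring
      simp only [Prod.mk.injEq, true_and]
      rw [h4]; field_simp; ring
  · intro d x y hx
    have hx' := sub_ne_zero.2 hx
    simp only [Finset.filter_filter]
    simp only [invF, affF, reduceCtorEq, false_and, and_false, Finset.filter_false,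
      Finset.card_empty, mul_zero, add_zero, Option.some.injEq, ite_eq_iff, false_or, and_true,
      or_false]
    rw [← hr']
    refine Finset.card_nbij' (fun t => t.1) (fun a => (a, y - a / (x - d), d))
      (by intro t; simp; tauto) ?_ ?_ (by intro t; simp)
    · intro a
      simp only [Finset.coe_filter, Finset.mem_univ, true_and, Set.mem_ofPred_eq]
      intro ha
      exact ⟨ha, hx, by ring⟩
    · rintro ⟨a, c', d'⟩
      simp only [Finset.coe_filter, Finset.mem_univ, true_and, Set.mem_ofPred_eq]
      rintro ⟨_, rfl, h2, h3⟩
      simp only [Prod.mk.injEq, true_and, and_true]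
      rw [← h3]; ring
  · intro x x' y y' hx hy
    have hx' := sub_ne_zero.2 hx
    have hy' := sub_ne_zero.2 hy
    simp only [Finset.filter_filter]
    simp only [invF, affF, reduceCtorEq, and_false, Option.some.injEq, ite_eq_iff, false_or,
      one_mul]
    set l := (y - y') / (x - x') with hl
    have hl0 : l ≠ 0 := div_ne_zero hy' hx'
    have e1 : (Finset.univ.filter (fun t : F × F => P t.1 ∧ t.1 * x + t.2 = y ∧
        t.1 * x' + t.2 = y')).card = if P l then 1 else 0 := by
      have hh : ∀ t : F × F, (t.1 * x + t.2 = y ∧ t.1 * x' + t.2 = y') ↔ t = (l, y - l * x) := by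
        rintro ⟨a, b⟩
        simp only [Prod.mk.injEq]
        constructor
        · rintro ⟨h1, h2⟩
          have : a = l := by
            rw [hl, eq_div_iff hx']
            linear_combination h1 - h2
          refine ⟨this, ?_⟩
          rw [← this, ← h1]; ring
        · rintro ⟨rfl, rfl⟩
          refine ⟨by ring, ?_⟩
          have : l * (x - x') = y - y' := by rw [hl]; field_simp
          linear_combination -this
      simp only [hh]
      split_ifs with h
      · rw [Finset.card_eq_one]
        refine ⟨(l, y - l * x), ?_⟩
        ext t
        simp only [Finset.mem_filter, Finset.mem_univ, true_and, Finset.mem_singleton]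
        constructor
        · exact fun h => h.2
        · rintro rfl
          exact ⟨h, rfl⟩
      · rw [Finset.card_eq_zero, Finset.filter_eq_empty_iff]
        rintro t - ⟨h1, rfl⟩
        exact h h1
    have e2 : (Finset.univ.filter (fun t : F × F × F => P (-t.1) ∧
        (¬x = t.2.2 ∧ t.2.1 + t.1 / (x - t.2.2) = y) ∧
        ¬x' = t.2.2 ∧ t.2.1 + t.1 / (x' - t.2.2) = y')).card =
        (Finset.univ.filter (fun w : F => P (l * w) ∧ w ≠ 1)).card := by
      have main : ∀ d, x ≠ d → x' ≠ d → 
          (P (-(-(l * (x - d) * (x' - d)))) ↔ P (l * ((x - d) / (x' - d)))) := by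
        intro d h1 h2
        rw [← hP (l * ((x - d) / (x' - d))) (x' - d) (sub_ne_zero.2 h2)]
        have h2 := sub_ne_zero.2 h2
        have : (-(-(l * (x - d) * (x' - d)))) = l * ((x - d) / (x' - d)) * (x' - d) ^ 2 := by
          field_simp
        rw [this]
      have ha : ∀ a c d, x ≠ d → x' ≠ d → c + a / (x - d) = y → c + a / (x' - d) = y' →
          a = -(l * (x - d) * (x' - d)) := by
        intro a c d h1 h2 h3 h4
        have h1 := sub_ne_zero.2 h1
        have h2 := sub_ne_zero.2 h2
        rw [hl, ← h3, ← h4]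
        field_simp
        ring
      refine Finset.card_nbij' (fun t => (x - t.2.2) / (x' - t.2.2))
        (fun w => (-(l * (x - (x - w * x') / (1 - w)) * (x' - (x - w * x') / (1 - w))),
          y + l * (x' - (x - w * x') / (1 - w)), (x - w * x') / (1 - w))) ?_ ?_ ?_ ?_
      · rintro ⟨a, c, d⟩
        simp only [Finset.coe_filter, Finset.mem_univ, true_and, Set.mem_ofPred_eq]
        rintro ⟨h1, ⟨h2, h3⟩, h4, h5⟩
        have h6 := ha a c d h2 h4 h3 h5
        rw [h6] at h1
        refine ⟨(main d h2 h4).1 h1, ?_⟩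
        rw [ne_eq, div_eq_one_iff_eq (sub_ne_zero.2 h4)]
        intro h; apply hx; linear_combination h
      · intro w
        simp only [Finset.coe_filter, Finset.mem_univ, true_and, Set.mem_ofPred_eq]
        rintro ⟨h1, h2⟩
        have hw0 : w ≠ 0 := by rintro rfl; simp [h0] at h1
        have hw1 : 1 - w ≠ 0 := sub_ne_zero.2 (Ne.symm h2)
        set d := (x - w * x') / (1 - w) with hd
        have d1 : x - d = w * (x' - x) / (1 - w) := by rw [hd]; field_simp; ring
        have d2 : x' - d = (x' - x) / (1 - w) := by rw [hd]; field_simp; ring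
        have hx2 : x' - x ≠ 0 := sub_ne_zero.2 (Ne.symm hx)
        have n1 : x - d ≠ 0 := by rw [d1]; exact div_ne_zero (mul_ne_zero hw0 hx2) hw1
        have n2 : x' - d ≠ 0 := by rw [d2]; exact div_ne_zero hx2 hw1
        have d3 : (x - d) / (x' - d) = w := by rw [d1, d2]; field_simp
        have hlx : l * (x - x') = y - y' := by rw [hl]; field_simp
        refine ⟨?_, ⟨sub_ne_zero.1 n1, ?_⟩, sub_ne_zero.1 n2, ?_⟩
        · rw [main d (sub_ne_zero.1 n1) (sub_ne_zero.1 n2), d3]; exact h1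
        · field_simp; ring
        · have : -(l * (x - d) * (x' - d)) / (x' - d) = -(l * (x - d)) := by field_simp
          rw [this]
          linear_combination -hlx
      · rintro ⟨a, c, d⟩
        simp only [Finset.coe_filter, Finset.mem_univ, true_and, Set.mem_ofPred_eq]
        rintro ⟨h1, ⟨h2, h3⟩, h4, h5⟩
        have h6 := ha a c d h2 h4 h3 h5
        have n2 := sub_ne_zero.2 h2
        have n4 := sub_ne_zero.2 h4
        have hx2 : x' - x ≠ 0 := sub_ne_zero.2 (Ne.symm hx)
        have hd : (x - (x - d) / (x' - d) * x') / (1 - (x - d) / (x' - d)) = d := by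
          have q : 1 - (x - d) / (x' - d) = (x' - x) / (x' - d) := by field_simp; ring
          rw [q]; field_simp; ring
        rw [hd, ← h6]
        simp only [Prod.mk.injEq, true_and, and_true]
        rw [← h3, h6]
        field_simp; ring
      · intro w
        simp only [Finset.coe_filter, Finset.mem_univ, true_and, Set.mem_ofPred_eq]
        rintro ⟨h1, h2⟩
        have hw1 : 1 - w ≠ 0 := sub_ne_zero.2 (Ne.symm h2)
        have hx2 : x' - x ≠ 0 := sub_ne_zero.2 (Ne.symm hx)
        have d1 : x - (x - w * x') / (1 - w) = w * (x' - x) / (1 - w) := by field_simp; ring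
        have d2 : x' - (x - w * x') / (1 - w) = (x' - x) / (1 - w) := by field_simp; ring
        rw [d1, d2]; field_simp
    rw [e1, e2]
    have e3 : (Finset.univ.filter (fun w => P (l * w))).card = r := by
      rw [← hr]
      refine Finset.card_nbij' (fun a => l * a) (fun a => a / l) (by intro a; simp) ?_ ?_ ?_
      · intro a; simp [mul_div_cancel₀ _ hl0]
      · intro a _; field_simp
      · intro a _; field_simp
    rw [← e3, ← Finset.card_filter_add_card_filter_not (s := Finset.univ.filter (fun w => P (l * w)))
      (fun w => w ≠ 1), Finset.filter_filter, Finset.filter_filter]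
    congr 1
    simp only [not_not]
    split_ifs with h
    · symm
      rw [Finset.card_eq_one]
      refine ⟨1, ?_⟩
      ext w
      simp only [Finset.mem_filter, Finset.mem_univ, true_and, Finset.mem_singleton]
      constructor
      · exact fun h => h.2
      · rintro rfl
        simpa using h
    · symm
      rw [Finset.card_eq_zero, Finset.filter_eq_empty_iff]
      rintro w - ⟨h1, rfl⟩
      simp [h] at h1

theorem card_two (x x' : F) (h : x ≠ x') :
    (Finset.univ.filter (fun z : F => x ≠ z ∧ x' ≠ z)).card = Fintype.card F - 2 := by
  have : Finset.univ.filter (fun z : F => x ≠ z ∧ x' ≠ z) = ({x, x'} : Finset F)ᶜ := by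
    ext z; simp [eq_comm]
  rw [this, Finset.card_compl, Finset.card_pair h]

theorem UW_pro : UW (Option F) (Fintype.card F - 2) := by
  have hr := card_two (0 : F) 1 (by simp)
  refine UW.of_fam _ (Fintype.card F - 2)
    (Finset.univ.filter (fun t : F × F × F => 0 ≠ t.1 ∧ 1 ≠ t.1)) proF ?_
    (Finset.univ : Finset F) (fun s => affF (1, s)) ?_ _ (fun _ _ _ _ => rfl) ?_ ?_ ?_ ?_ ?_
  · intro t ht
    apply proF_inj
    intro h
    simp [h] at ht
  · intro t ht
    apply affF_inj
    simp
  · intro x y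
    simp only [Finset.filter_filter]
    simp only [proF, affF, reduceCtorEq, false_and, and_false, Finset.filter_false, true_and,
      Finset.card_empty, zero_add, one_mul, Option.some.injEq]
    have : Finset.univ.filter (fun t : F => x + t = y) = {y - x} := by
      ext t; simp [eq_sub_iff_add_eq, add_comm]
    rw [this]; simp
  · intro x y
    simp only [Finset.filter_filter]
    simp only [proF, affF, reduceCtorEq, false_and, and_false, Finset.filter_false,
      Finset.card_empty, mul_zero, add_zero, Option.some.injEq, ite_eq_left_iff, imp_false, not_not]
    rw [← hr]
    exact Finset.card_nbij' (fun t => t.1) (fun a => (a, y - a * x, x)) (by intro t; simp; tauto)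
      (by intro t; simp) (by rintro ⟨a, b, c⟩; simp; rintro _ _ rfl rfl; simp)
      (by intro t; simp)
  · intro c x y hy
    have hy' := sub_ne_zero.2 hy
    simp only [Finset.filter_filter]
    simp only [proF, affF, reduceCtorEq, false_and, and_false, Finset.filter_false,
      Finset.card_empty, mul_zero, add_zero, Option.some.injEq, ite_eq_iff, false_or]
    rw [← hr]
    refine Finset.card_nbij' (fun t => t.1) (fun a => (a, y - a * x, x - (y - c) / a))
      (by intro t; simp; tauto) ?_ ?_ (by intro t; simp)
    · intro a
      simp only [Finset.coe_filter, Finset.mem_univ, true_and, Set.mem_ofPred_eq]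
      rintro ⟨ha, ha1⟩
      have ha0 := ha.symm
      refine ⟨⟨ha, ha1⟩, by field_simp; ring, ?_, by ring⟩
      intro h
      have : (y - c) / a = 0 := by linear_combination h
      simp [ha0, hy'] at this
    · rintro ⟨a, b, i⟩
      simp only [Finset.coe_filter, Finset.mem_univ, true_and, Set.mem_ofPred_eq]
      rintro ⟨⟨h, _⟩, rfl, h2, rfl⟩
      have ha0 := h.symm
      simp only [Prod.mk.injEq, true_and]
      refine ⟨by ring, by field_simp; ring⟩
  · intro d x y hx
    simp only [Finset.filter_filter]
    simp only [proF, affF, reduceCtorEq, false_and, and_false, Finset.filter_false,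
      Finset.card_empty, mul_zero, add_zero, Option.some.injEq, ite_eq_iff, false_or, and_true,
      or_false]
    rw [← hr]
    refine Finset.card_nbij' (fun t => t.1) (fun a => (a, y - a * x, d))
      (by intro t; simp; tauto) ?_ ?_ (by intro t; simp)
    · intro a
      simp only [Finset.coe_filter, Finset.mem_univ, true_and, Set.mem_ofPred_eq]
      intro ha
      exact ⟨ha, hx, by ring⟩
    · rintro ⟨a, b, i⟩
      simp only [Finset.coe_filter, Finset.mem_univ, true_and, Set.mem_ofPred_eq]
      rintro ⟨_, rfl, h2, rfl⟩
      simp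
  · intro x x' y y' hx hy
    have hx' := sub_ne_zero.2 hx
    have hy' := sub_ne_zero.2 hy
    simp only [Finset.filter_filter]
    simp only [proF, affF, reduceCtorEq, and_false, Option.some.injEq, ite_eq_iff, false_or,
      one_mul]
    set l := (y - y') / (x - x') with hl
    have hl0 : l ≠ 0 := div_ne_zero hy' hx'
    have hlx : l * (x - x') = y - y' := by rw [hl]; field_simp
    have ha : ∀ a b, a * x + b = y → a * x' + b = y' → a = l ∧ b = y - l * x := by
      intro a b h1 h2
      have : a = l := by
        rw [hl, eq_div_iff hx']
        linear_combination h1 - h2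
      refine ⟨this, ?_⟩
      rw [← this, ← h1]; ring
    by_cases h1 : l = 1
    · have e1 : (Finset.univ.filter (fun t : F × F × F => (0 ≠ t.1 ∧ 1 ≠ t.1) ∧
          (¬x = t.2.2 ∧ t.1 * x + t.2.1 = y) ∧ ¬x' = t.2.2 ∧ t.1 * x' + t.2.1 = y')) = ∅ := by
        rw [Finset.filter_eq_empty_iff]
        rintro ⟨a, b, i⟩ - ⟨⟨h2, h3⟩, ⟨h4, h5⟩, h6, h7⟩
        exact h3 (by rw [← h1]; exact (ha a b h5 h7).1.symm)
      have e2 : Finset.univ.filter (fun t : F => x + t = y ∧ x' + t = y') = {y - x} := by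
        ext t
        simp only [Finset.mem_filter, Finset.mem_univ, true_and, Finset.mem_singleton]
        constructor
        · rintro ⟨h, _⟩; rw [← h]; ring
        · rintro rfl
          rw [h1] at hlx
          exact ⟨by ring, by linear_combination -hlx⟩
      rw [e1, e2]; simp
    · have e2 : Finset.univ.filter (fun t : F => x + t = y ∧ x' + t = y') = ∅ := by
        rw [Finset.filter_eq_empty_iff]
        rintro t - ⟨h2, h3⟩
        exact h1 (ha 1 t (by rw [one_mul, h2]) (by rw [one_mul, h3])).1.symm
      rw [e2, Finset.card_empty, mul_zero, add_zero, ← card_two x x' hx]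
      refine Finset.card_nbij' (fun t => t.2.2) (fun i => (l, y - l * x, i))
        (by intro t; simp; tauto) ?_ ?_ (by intro t; simp)
      · intro i
        simp only [Finset.coe_filter, Finset.mem_univ, true_and, Set.mem_ofPred_eq]
        rintro ⟨h3, h4⟩
        exact ⟨⟨hl0.symm, Ne.symm h1⟩, ⟨h3, by ring⟩, h4, by linear_combination -hlx⟩
      · rintro ⟨a, b, i⟩
        simp only [Finset.coe_filter, Finset.mem_univ, true_and, Set.mem_ofPred_eq]
        rintro ⟨⟨h2, h3⟩, ⟨h4, h5⟩, h6, h7⟩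
        obtain ⟨rfl, rfl⟩ := ha a b h5 h7
        rfl

theorem UW_pgl : UW (Option F) (Fintype.card F - 1) := by
  refine UW_inv (fun a => a ≠ 0) _ (by simp) ?_ ?_
  · intro a b hb; simp [hb]
  · rw [Finset.filter_ne', Finset.card_erase_of_mem (Finset.mem_univ _), Finset.card_univ]

theorem UW_psl (hodd : Odd (Fintype.card F)) : UW (Option F) ((Fintype.card F - 1) / 2) := by
  have hF : ringChar F ≠ 2 := by
    intro h
    have := FiniteField.even_card_of_char_two h
    rw [Nat.odd_iff] at hodd
    omega
  refine UW_inv (fun a => quadraticChar F a = 1) _ (by simp) ?_ ?_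
  · intro a b hb
    rw [map_mul, map_pow, quadraticChar_sq_one hb, mul_one]
  · have h1 := quadraticChar_sum_zero hF
    have h2 : ∀ a : F, quadraticChar F a = (if quadraticChar F a = 1 then 2 else 0)
        - 1 + (if a = 0 then 1 else 0) := by
      intro a
      by_cases ha : a = 0
      · simp [ha]
      · rcases quadraticChar_dichotomy ha with h | h <;> simp [h, ha]
    rw [Finset.sum_congr rfl (fun a _ => h2 a), Finset.sum_add_distrib, Finset.sum_sub_distrib,
      ← Finset.sum_filter] at h1
    simp [-quadraticChar_apply] at h1
    have := Fintype.card_pos (α := F)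
    omega

end fams

theorem exists_field_pp (n : ℕ) (hpp : IsPrimePow n) :
    ∃ (F : Type) (_ : Field F) (_ : Fintype F), Fintype.card F = n := by
  have : IsPrimePow (Fintype.card (Fin n)) := by simpa using hpp
  obtain ⟨f⟩ := Fintype.nonempty_field_iff.2 this
  exact ⟨Fin n, f, inferInstance, by simp⟩

/-- If `n > 2` is a prime power, then a uniform `((n+1)×(n+1))/(μn)` semi-Latin square
exists for every positive integer `μ ≥ (n−3)(n−2)`; and if moreover `n` is odd, for
every positive integer `μ ≥ (n−3)((n−1)/2 − 1)`. -/
theorem exists_uniform_sls_prime_power (n : ℕ) (hn : 2 < n) (hpp : IsPrimePow n) :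
    (∀ μ : ℕ, 0 < μ → (n - 3) * (n - 2) ≤ μ →
      ∃ S : SemiLatinSquare (n + 1) (μ * n), S.IsUniform) ∧
    (Odd n → ∀ μ : ℕ, 0 < μ → (n - 3) * ((n - 1) / 2 - 1) ≤ μ →
      ∃ S : SemiLatinSquare (n + 1) (μ * n), S.IsUniform) := by
  classical
  obtain ⟨F, _, _, hF⟩ := exists_field_pp n hpp
  have hX : Fintype.card (Option F) = n + 1 := by simp [hF]
  have hpro : UW (Option F) (n - 2) := hF ▸ UW_pro (F := F)
  have hpgl : UW (Option F) (n - 1) := hF ▸ UW_pgl (F := F)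
  constructor
  · intro μ hμ h
    have hc : Nat.gcd (n - 2) (n - 1) = 1 := by
      have : n - 1 = (n - 2) + 1 := by omega
      rw [this]; simp
    obtain ⟨a, b, hab⟩ := Nat.exists_add_mul_eq_of_gcd_dvd_of_mul_pred_le (n - 2) (n - 1) μ
      (by rw [hc]; simp) (by simpa [Nat.pred_eq_sub_one, Nat.sub_sub] using h)
    exact UW.toSLS (by omega) hμ hX (hab ▸ hpro.add hpgl a b)
  · intro hodd μ hμ h
    have hpsl : UW (Option F) ((n - 1) / 2) := by
      have := UW_psl (F := F) (hF ▸ hodd)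
      rwa [hF] at this
    have hc : Nat.gcd (n - 2) ((n - 1) / 2) = 1 := by
      obtain ⟨k, rfl⟩ := hodd
      obtain ⟨k, rfl⟩ : ∃ j, k = j + 1 := ⟨k - 1, by omega⟩
      have e1 : 2 * (k + 1) + 1 - 2 = k + (k + 1) := by omega
      have e2 : (2 * (k + 1) + 1 - 1) / 2 = k + 1 := by omega
      rw [e1, e2]; simp
    obtain ⟨a, b, hab⟩ := Nat.exists_add_mul_eq_of_gcd_dvd_of_mul_pred_le (n - 2) ((n - 1) / 2) μ
      (by rw [hc]; simp) (by simpa [Nat.pred_eq_sub_one, Nat.sub_sub] using h)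
    exact UW.toSLS (by omega) hμ hX (hab ▸ hpro.add hpsl a b)
end

section
/- Let n > 2 and μ ≥ 1 be integers, and suppose there exists a uniform (n×n)/(μ(n−1)) semi-Latin square. Then there exists an affine resolvable (μn², n², n, μn)-design. -/
open Polynomial

theorem uniform_param_eq {n μ ν : ℕ} (hn : 2 < n) (S : SemiLatinSquare n (μ * (n - 1)))
    (h : S.UniformWith ν) : ν = μ := by
  classical
  let i : Fin n := ⟨0, by omega⟩
  let i' : Fin n := ⟨1, by omega⟩
  have hi : i ≠ i' := by simp [i, i']
  have hd : S.block i i = Finset.univ.biUnion (fun j' => S.block i i ∩ S.block i' j') := by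
    ext α
    simp only [Finset.mem_biUnion, Finset.mem_univ, true_and, Finset.mem_inter]
    constructor
    · intro ha
      obtain ⟨j, hj, _⟩ := S.row_once i' α
      exact ⟨j, ha, hj⟩
    · rintro ⟨j, ha, _⟩
      exact ha
  have hc := congrArg Finset.card hd
  rw [S.blockSize, Finset.card_biUnion] at hc
  · have h0 : ∀ j' : Fin n, (S.block i i ∩ S.block i' j').card = if j' = i then 0 else ν := by
      intro j'
      split_ifs with hj
      · subst hj
        rw [Finset.card_eq_zero, Finset.eq_empty_iff_forall_notMem]
        intro α ha
        rw [Finset.mem_inter] at ha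
        exact hi ((S.col_once _ α).unique ha.1 ha.2)
      · exact h.2 _ _ _ _ hi (Ne.symm hj)
    simp only [h0] at hc
    rw [Finset.sum_ite] at hc
    simp [Finset.filter_ne'] at hc
    have : 0 < n - 1 := by omega
    rw [mul_comm μ] at hc
    exact (Nat.eq_of_mul_eq_mul_left this hc).symm
  · intro a _ b _ hab
    rw [Function.onFun, Finset.disjoint_left]
    intro α ha hb
    rw [Finset.mem_inter] at ha hb
    exact hab ((S.row_once i' α).unique ha.2 hb.2)

/-- If a uniform `(n×n)/(μ(n−1))` semi-Latin square exists (`n > 2`, `μ ≥ 1`), then an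
affine resolvable `(μn², n², n, μn)`-design exists. -/
theorem affine_resolvable_from_uniform_sls (n μ : ℕ) (hn : 2 < n) (hμ : 1 ≤ μ)
    (hex : ∃ S : SemiLatinSquare n (μ * (n - 1)), S.IsUniform) :
    ∃ D : BlockDesign (μ * n ^ 2) (n ^ 2) n (μ * n), D.IsAffineResolvable := by
  classical
  obtain ⟨S, ν, hS⟩ := hex
  obtain rfl := uniform_param_eq hn S hS
  obtain ⟨m, rfl⟩ : ∃ m, n = m + 1 := ⟨n - 1, by omega⟩
  have hT : Fintype.card (Fin ((m + 1) * (ν * (m + 1 - 1))) ⊕ Fin (m + 1) × Fin ν)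
      = ν * (m + 1) ^ 2 := by
    simp
    ring
  have hB : Fintype.card (Fin (m + 1) × Fin (m + 1)) = (m + 1) ^ 2 := by
    simp
    ring
  let e := Fintype.equivFinOfCardEq hT
  let f := Fintype.equivFinOfCardEq hB
  let bl : Fin (m + 1) → Fin (m + 1) →
      Finset (Fin ((m + 1) * (ν * (m + 1 - 1))) ⊕ Fin (m + 1) × Fin ν) :=
    fun i j => (S.block i j).disjSum ({j} ×ˢ Finset.univ)
  have hbl : ∀ i t, ∃! j, t ∈ bl i j := by
    rintro i (α | ⟨c, t⟩)
    · simpa [bl] using S.row_once i α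
    · exact ⟨c, by simp [bl], by intro y hy; simpa [bl, eq_comm] using hy⟩
  let B : Fin ((m + 1) ^ 2) → Finset (Fin (ν * (m + 1) ^ 2)) :=
    fun x => (bl (f.symm x).1 (f.symm x).2).map e.toEmbedding
  have hmem : ∀ α x, α ∈ B x ↔ e.symm α ∈ bl (f.symm x).1 (f.symm x).2 := by
    intro α x
    simp [B, Finset.mem_map_equiv]
  have hres : ∀ (c : Fin (m + 1)) (α : Fin (ν * (m + 1) ^ 2)),
      ∃! x, (f.symm x).1 = c ∧ α ∈ B x := by
    intro c α
    obtain ⟨j, hj, hu⟩ := hbl c (e.symm α)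
    refine ⟨f (c, j), ⟨by simp, by rw [hmem]; simpa using hj⟩, ?_⟩
    rintro x ⟨hx, hx'⟩
    rw [hmem, hx] at hx'
    rw [← hu _ hx', ← hx]
    simp
  have hsize : ∀ x, (B x).card = ν * (m + 1) := by
    intro x
    simp [B, bl, Finset.card_disjSum, S.blockSize]
    ring
  have hrep : ∀ α, (Finset.univ.filter fun x => α ∈ B x).card = m + 1 := by
    intro α
    refine Eq.trans ?_ (Finset.card_fin (m + 1))
    refine Finset.card_bij (fun x _ => (f.symm x).1) (by simp) ?_ ?_
    · intro x hx y hy hxy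
      exact (hres (f.symm y).1 α).unique ⟨hxy, (Finset.mem_filter.1 hx).2⟩
        ⟨rfl, (Finset.mem_filter.1 hy).2⟩
    · intro c _
      obtain ⟨x, hx, _⟩ := hres c α
      exact ⟨x, by simpa using hx.2, hx.1⟩
  refine ⟨⟨B, hsize, hrep⟩, ?_, by omega, fun x => (f.symm x).1, hres, ν, hμ, ?_⟩
  · have : 0 < ν * (m + 1) := by positivity
    nlinarith
  · intro x y hxy
    change (B x ∩ B y).card = ν
    have hxy' : (f.symm x).1 ≠ (f.symm y).1 := hxy
    simp only [B]
    rw [← Finset.map_inter, Finset.card_map]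
    generalize f.symm x = p at *
    generalize f.symm y = q at *
    obtain ⟨i, j⟩ := p
    obtain ⟨i', j'⟩ := q
    have hI : bl i j ∩ bl i' j' = (S.block i j ∩ S.block i' j').disjSum
        (({j} ∩ {j'}) ×ˢ Finset.univ) := by
      ext (α | ⟨c, t⟩) <;> simp [bl, eq_comm]
    simp only at hxy' ⊢
    rw [hI, Finset.card_disjSum, Finset.card_product]
    by_cases hj : j = j'
    · subst hj
      have : S.block i j ∩ S.block i' j = ∅ := by
        rw [Finset.eq_empty_iff_forall_notMem]
        intro α ha
        rw [Finset.mem_inter] at ha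
        exact hxy' ((S.col_once _ α).unique ha.1 ha.2)
      simp [this]
    · rw [hS.2 _ _ _ _ hxy' hj]
      simp [hj]
end

section
/- Let n > 2 and μ ≥ 1 be integers, and suppose there exists a uniform (n×n)/(μ(n−1)) semi-Latin square. Then there exists an (n², μn(n+1), μ(n+1), n, μ)-balanced incomplete-block design. -/
open Polynomial

theorem bibd_transport {V I : Type} [Fintype V] [Fintype I] (v b r k l : ℕ)
    (hV : Fintype.card V = v) (hI : Fintype.card I = b) (w : I → V → ℕ)
    (hw : ∀ x p, w x p = 0 ∨ w x p = 1)
    (h1 : ∀ x, (∑ p : V, w x p) = k)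
    (h2 : ∀ p, (∑ x : I, w x p) = r)
    (h3 : ∀ p q, p ≠ q → (∑ x : I, w x p * w x q) = l)
    (hk : 1 < k) (hkv : k < v) :
    ∃ D : BlockDesign v b r k, D.IsBIBD l := by
  let e : Fin v ≃ V := (Fintype.equivFinOfCardEq hV).symm
  let f : Fin b ≃ I := (Fintype.equivFinOfCardEq hI).symm
  have hw1 : ∀ x p, (if w x p = 1 then 1 else 0) = w x p := by
    intro x p
    rcases hw x p with h | h <;> simp [h]
  have hw2 : ∀ x p q, (if w x p = 1 ∧ w x q = 1 then 1 else 0) = w x p * w x q := by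
    intro x p q
    rcases hw x p with h | h <;> rcases hw x q with h' | h' <;> simp [h, h']
  refine ⟨⟨fun j => Finset.univ.filter fun a => w (f j) (e a) = 1, ?_, ?_⟩, hk, hkv, ?_⟩
  · intro j
    rw [Finset.card_filter, ← h1 (f j)]
    simp only [hw1]
    exact Equiv.sum_comp e (fun p => w (f j) p)
  · intro a
    rw [Finset.card_filter, ← h2 (e a)]
    simp only [Finset.mem_filter, Finset.mem_univ, true_and, hw1]
    exact Equiv.sum_comp f (fun x => w x (e a))
  · intro a c hac
    unfold BlockDesign.concurrence
    rw [Finset.card_filter, ← h3 (e a) (e c) (fun h => hac (e.injective h))]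
    simp only [Finset.mem_filter, Finset.mem_univ, true_and, hw2]
    exact Equiv.sum_comp f (fun x => w x (e a) * w x (e c))

theorem sls_sum_one {n : ℕ} (P : Fin n → Prop) [DecidablePred P] (h : ∃! j, P j) :
    (∑ j, if P j then 1 else 0) = 1 := by
  rw [← Finset.card_filter, Finset.card_eq_one]
  obtain ⟨j, hj, hu⟩ := h
  refine ⟨j, ?_⟩
  ext x
  simp only [Finset.mem_filter, Finset.mem_univ, true_and, Finset.mem_singleton]
  exact ⟨hu x, fun h => h ▸ hj⟩

theorem sls_mu {n k m : ℕ} (hn : 2 < n) (S : SemiLatinSquare n k) (h : S.UniformWith m) :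
    k = m * (n - 1) := by
  classical
  let i0 : Fin n := ⟨0, by omega⟩
  let i1 : Fin n := ⟨1, by omega⟩
  have h01 : i0 ≠ i1 := by simp [i0, i1]
  have key : ∑ j, (S.block i0 i0 ∩ S.block i1 j).card = k := by
    have : ∀ j, (S.block i0 i0 ∩ S.block i1 j).card
        = ∑ a ∈ S.block i0 i0, if a ∈ S.block i1 j then 1 else 0 := by
      intro j
      rw [← Finset.card_filter, Finset.filter_mem_eq_inter]
    simp only [this]
    rw [Finset.sum_comm]
    rw [Finset.sum_congr rfl (fun a _ => sls_sum_one _ (S.row_once i1 a))]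
    simp [S.blockSize]
  have h0 : (S.block i0 i0 ∩ S.block i1 i0).card = 0 := by
    rw [Finset.card_eq_zero, Finset.eq_empty_iff_forall_notMem]
    intro a ha
    rw [Finset.mem_inter] at ha
    exact h01 ((S.col_once i0 a).unique ha.1 ha.2)
  rw [← Finset.add_sum_erase _ _ (Finset.mem_univ i0), h0,
    Finset.sum_congr rfl (fun j hj => h.2 i0 i0 i1 j h01 (Finset.ne_of_mem_erase hj).symm)] at key
  simp at key
  rw [← key, mul_comm]

theorem bibd_from_uniform_sls (n μ : ℕ) (hn : 2 < n) (hμ : 1 ≤ μ)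
    (hex : ∃ S : SemiLatinSquare n (μ * (n - 1)), S.IsUniform) :
    ∃ D : BlockDesign (n ^ 2) (μ * n * (n + 1)) (μ * (n + 1)) n, D.IsBIBD μ := by
  classical
  obtain ⟨S, m, hS⟩ := hex
  have hm : μ = m := Nat.eq_of_mul_eq_mul_right (by omega) (sls_mu hn S hS)
  subst hm
  obtain ⟨t, rfl⟩ : ∃ t, n = t + 1 := ⟨n - 1, by omega⟩
  refine bibd_transport (V := Fin (t+1) × Fin (t+1))
    (I := Fin ((t+1) * (μ * (t + 1 - 1))) ⊕ (Fin μ × (Fin (t+1) ⊕ Fin (t+1)))) _ _ _ _ _ ?_ ?_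
    (fun x p => Sum.elim (fun a => if a ∈ S.block p.1 p.2 then 1 else 0)
      (fun y => Sum.elim (fun i => if p.1 = i then 1 else 0)
        (fun j => if p.2 = j then 1 else 0) y.2) x) ?_ ?_ ?_ ?_ (by omega)
      (by nlinarith)
  · simp [sq]
  · simp; ring
  · rintro (a | ⟨c, i | j⟩) p
    · by_cases h : a ∈ S.block p.1 p.2 <;> simp [h]
    · by_cases h : p.1 = i <;> simp [h]
    · by_cases h : p.2 = j <;> simp [h]
  · rintro (a | ⟨c, i | j⟩)
    · simp only [Sum.elim_inl]
      rw [Fintype.sum_prod_type]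
      simp only [sls_sum_one _ (S.row_once _ a)]
      simp
    · simp only [Sum.elim_inr, Sum.elim_inl]
      rw [Fintype.sum_prod_type_right]
      simp
    · simp only [Sum.elim_inr, Sum.elim_inl]
      rw [Fintype.sum_prod_type]
      simp
  · rintro ⟨i, j⟩
    have := S.blockSize i j
    simp [Fintype.sum_sum_type, Fintype.sum_prod_type, this]
    ring
  · rintro ⟨i, j⟩ ⟨i', j'⟩ hne
    have h0 : (∑ a, (if a ∈ S.block i j then 1 else 0) * (if a ∈ S.block i' j' then 1 else 0))
        = (S.block i j ∩ S.block i' j').card := by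
      rw [← Finset.filter_mem_eq_inter, Finset.card_filter]
      simp [Finset.inter_comm]
    have hr : ∀ x y : Fin (t+1), (∑ z, (if x = z then 1 else 0) * (if y = z then 1 else 0)) = if x = y then 1 else 0 := by
      intro x y
      simp [eq_comm]
    simp only [Fintype.sum_sum_type, Fintype.sum_prod_type, Sum.elim_inl, Sum.elim_inr, h0, hr]
    by_cases hi : i = i'
    · subst hi
      have hj : j ≠ j' := fun h => hne (by rw [h])
      have : S.block i j ∩ S.block i j' = ∅ := by
        rw [Finset.eq_empty_iff_forall_notMem]
        intro a ha
        rw [Finset.mem_inter] at ha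
        exact hj ((S.row_once i a).unique ha.1 ha.2)
      simp [this, hj]
    · by_cases hj : j = j'
      · subst hj
        have : S.block i j ∩ S.block i' j = ∅ := by
          rw [Finset.eq_empty_iff_forall_notMem]
          intro a ha
          rw [Finset.mem_inter] at ha
          exact hi ((S.col_once j a).unique ha.1 ha.2)
        simp [this, hi]
      · simp [hS.2 i j i' j' hi hj, hi, hj]
end
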